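/- arXiv:1504.05171 — 2 statements merged into one kernel-verified Lean document; each statement's English description precedes it below -/
import Mathlib

section
/- Let n ≥ 3 and let I = I^{perm_n,2} be the ideal of S generated by all 2×2 sub-permanents of the generic n×n matrix. Define f_0 = n², f_1 = C(n²,2) − C(n,2)², f_2 = 2·C(n,2)² + 2n·C(n,3), and f_i = 2n·C(n,i+1) for 3 ≤ i ≤ n−1. Then for every integer t > n, the dimension of the degree-t homogeneous component of the quotient ring S/I equals Σ_{i=0}^{n−1} f_i · C(t−1, i); i.e., the Hilbert polynomial of S/I is Σ_{i=0}^{n−1} f_i·C(t−1,i). -/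
open MvPolynomial

/-- The sub-permanent `perm_{R,C}` of the generic `n × n` matrix. -/
noncomputable def subPerm {n κ : ℕ} {R C : Finset (Fin n)} (hR : R.card = κ) (hC : C.card = κ) :
    MvPolynomial (Fin n × Fin n) ℂ :=
  ∑ σ : Equiv.Perm (Fin κ), ∏ i : Fin κ,
    X ((R.orderIsoOfFin hR i : Fin n), (C.orderIsoOfFin hC (σ i) : Fin n))

/-- The ideal generated by all `κ × κ` sub-permanents of the generic `n × n` matrix. -/
noncomputable def permIdeal (n κ : ℕ) : Ideal (MvPolynomial (Fin n × Fin n) ℂ) :=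
  Ideal.span {p | ∃ (R C : Finset (Fin n)) (hR : R.card = κ) (hC : C.card = κ), p = subPerm hR hC}

noncomputable def rowS {n : ℕ} (m : Fin n × Fin n →₀ ℕ) : Fin n →₀ ℕ := m.mapDomain Prod.fst
noncomputable def colS {n : ℕ} (m : Fin n × Fin n →₀ ℕ) : Fin n →₀ ℕ := m.mapDomain Prod.snd

noncomputable abbrev ee {n : ℕ} (i j : Fin n) : Fin n × Fin n →₀ ℕ := Finsupp.single (i, j) 1
noncomputable abbrev dd {n : ℕ} (i : Fin n) : Fin n →₀ ℕ := Finsupp.single i 1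

lemma rowS_add {n : ℕ} (a b : Fin n × Fin n →₀ ℕ) : rowS (a + b) = rowS a + rowS b :=
  Finsupp.mapDomain_add
lemma colS_add {n : ℕ} (a b : Fin n × Fin n →₀ ℕ) : colS (a + b) = colS a + colS b :=
  Finsupp.mapDomain_add
lemma rowS_ee {n : ℕ} (i j : Fin n) : rowS (ee i j) = dd i := Finsupp.mapDomain_single
lemma colS_ee {n : ℕ} (i j : Fin n) : colS (ee i j) = dd j := Finsupp.mapDomain_single

lemma exists_split {α : Type*} (m : α →₀ ℕ) (a : α) (h : m a ≠ 0) :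
    ∃ m', m = m' + Finsupp.single a 1 := by
  refine ⟨m - Finsupp.single a 1, ?_⟩
  rw [tsub_add_cancel_of_le]
  rw [Finsupp.single_le_iff]
  omega

lemma subPerm_two {n : ℕ} {R C : Finset (Fin n)} (hR : R.card = 2) (hC : C.card = 2) :
    subPerm hR hC =
      X ((R.orderIsoOfFin hR 0 : Fin n), (C.orderIsoOfFin hC 0 : Fin n)) *
      X ((R.orderIsoOfFin hR 1 : Fin n), (C.orderIsoOfFin hC 1 : Fin n)) +
      X ((R.orderIsoOfFin hR 0 : Fin n), (C.orderIsoOfFin hC 1 : Fin n)) *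
      X ((R.orderIsoOfFin hR 1 : Fin n), (C.orderIsoOfFin hC 0 : Fin n)) := by
  have hu : (Finset.univ : Finset (Equiv.Perm (Fin 2))) = {1, Equiv.swap 0 1} := by decide
  unfold subPerm
  rw [hu, Finset.sum_pair (by decide)]
  simp [Fin.prod_univ_two]

lemma pair_iso {n : ℕ} {i k : Fin n} (R : Finset (Fin n)) (hRe : R = {i, k})
    (hR : R.card = 2) :
    ((R.orderIsoOfFin hR 0 : Fin n) = i ∧ (R.orderIsoOfFin hR 1 : Fin n) = k) ∨
    ((R.orderIsoOfFin hR 0 : Fin n) = k ∧ (R.orderIsoOfFin hR 1 : Fin n) = i) := by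
  have h0 := (R.orderIsoOfFin hR 0).2
  have h1 := (R.orderIsoOfFin hR 1).2
  have hne : (R.orderIsoOfFin hR 0 : Fin n) ≠ (R.orderIsoOfFin hR 1 : Fin n) := by
    intro h
    have := (R.orderIsoOfFin hR).injective (Subtype.ext h)
    simp at this
  generalize (R.orderIsoOfFin hR 0 : Fin n) = a at *
  generalize (R.orderIsoOfFin hR 1 : Fin n) = b at *
  rw [hRe] at h0 h1
  simp only [Finset.mem_insert, Finset.mem_singleton] at h0 h1
  grind

lemma swap_mem {n : ℕ} {i k j l : Fin n} (hik : i ≠ k) (hjl : j ≠ l) :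
    (X (i, j) * X (k, l) + X (i, l) * X (k, j) : MvPolynomial (Fin n × Fin n) ℂ)
      ∈ permIdeal n 2 := by
  have hR : ({i, k} : Finset (Fin n)).card = 2 := Finset.card_pair hik
  have hC : ({j, l} : Finset (Fin n)).card = 2 := Finset.card_pair hjl
  have hm : subPerm hR hC ∈ permIdeal n 2 := Ideal.subset_span ⟨_, _, hR, hC, rfl⟩
  rw [subPerm_two] at hm
  rcases pair_iso _ rfl hR with ⟨h1, h2⟩ | ⟨h1, h2⟩ <;>
  rcases pair_iso _ rfl hC with ⟨h3, h4⟩ | ⟨h3, h4⟩ <;>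
  rw [h1, h2, h3, h4] at hm <;> convert hm using 1 <;> ring

lemma mon_ee {n : ℕ} (u : Fin n × Fin n →₀ ℕ) (i j : Fin n) (a : ℂ) :
    (monomial (u + ee i j) a : MvPolynomial (Fin n × Fin n) ℂ) = monomial u a * X (i, j) := by
  rw [X, monomial_mul, mul_one]

lemma swap_mon {n : ℕ} {i k j l : Fin n} (u : Fin n × Fin n →₀ ℕ) (hik : i ≠ k) (hjl : j ≠ l) :
    (monomial (u + ee i j + ee k l) 1 + monomial (u + ee i l + ee k j) 1 :
      MvPolynomial (Fin n × Fin n) ℂ) ∈ permIdeal n 2 := by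
  simp only [mon_ee]
  have := Ideal.mul_mem_left _ (monomial u (1 : ℂ)) (swap_mem (n := n) hik hjl)
  convert this using 1
  ring

lemma triple_row {n : ℕ} {i k a b c : Fin n} (u : Fin n × Fin n →₀ ℕ) (hik : i ≠ k)
    (hab : a ≠ b) (hac : a ≠ c) (hbc : b ≠ c) :
    (monomial (u + ee i a + ee i b + ee k c) 1 : MvPolynomial (Fin n × Fin n) ℂ)
      ∈ permIdeal n 2 := by
  have h1 := Ideal.mul_mem_left _ (C (1/2 : ℂ) * monomial u (1 : ℂ) * X (i, b)) (swap_mem (n := n) hik hac)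
  have h2 := Ideal.mul_mem_left _ (C (1/2 : ℂ) * monomial u (1 : ℂ) * X (i, a)) (swap_mem (n := n) hik hbc)
  have h3 := Ideal.mul_mem_left _ (C (1/2 : ℂ) * monomial u (1 : ℂ) * X (i, c)) (swap_mem (n := n) hik hab)
  have := Ideal.sub_mem _ (Ideal.add_mem _ h1 h2) h3
  simp only [mon_ee]
  have hc : (C (1/2 : ℂ) : MvPolynomial (Fin n × Fin n) ℂ) * 2 = 1 := by
    rw [show (2 : MvPolynomial (Fin n × Fin n) ℂ) = C 2 from (map_ofNat C 2).symm, ← C_mul]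
    norm_num
  convert this using 1
  linear_combination (-(monomial u (1 : ℂ)) * X (i, a) * X (i, b) * X (k, c)) * hc

lemma triple_col {n : ℕ} {i k a b c : Fin n} (u : Fin n × Fin n →₀ ℕ) (hik : i ≠ k)
    (hab : a ≠ b) (hac : a ≠ c) (hbc : b ≠ c) :
    (monomial (u + ee a i + ee b i + ee c k) 1 : MvPolynomial (Fin n × Fin n) ℂ)
      ∈ permIdeal n 2 := by
  have h1 := Ideal.mul_mem_left _ (C (1/2 : ℂ) * monomial u (1 : ℂ) * X (b, i)) (swap_mem (n := n) hac hik)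
  have h2 := Ideal.mul_mem_left _ (C (1/2 : ℂ) * monomial u (1 : ℂ) * X (a, i)) (swap_mem (n := n) hbc hik)
  have h3 := Ideal.mul_mem_left _ (C (1/2 : ℂ) * monomial u (1 : ℂ) * X (c, i)) (swap_mem (n := n) hab hik)
  have := Ideal.sub_mem _ (Ideal.add_mem _ h1 h2) h3
  simp only [mon_ee]
  have hc : (C (1/2 : ℂ) : MvPolynomial (Fin n × Fin n) ℂ) * 2 = 1 := by
    rw [show (2 : MvPolynomial (Fin n × Fin n) ℂ) = C 2 from (map_ofNat C 2).symm, ← C_mul]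
    norm_num
  convert this using 1
  linear_combination (-(monomial u (1 : ℂ)) * X (a, i) * X (b, i) * X (c, k)) * hc

lemma exists_marg {n : ℕ} (t : ℕ) : ∀ (r c : Fin n →₀ ℕ), r.degree = t → c.degree = t →
    ∃ m : Fin n × Fin n →₀ ℕ, rowS m = r ∧ colS m = c := by
  induction t with
  | zero =>
    intro r c hr hc
    rw [Finsupp.degree_eq_zero_iff] at hr hc
    exact ⟨0, by rw [hr]; exact Finsupp.mapDomain_zero, by rw [hc]; exact Finsupp.mapDomain_zero⟩
  | succ t ih =>
    intro r c hr hc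
    have h1 : ∀ r : Fin n →₀ ℕ, r.degree = t + 1 → ∃ i r', r = r' + dd i ∧ r'.degree = t := by
      intro r hr
      have : r ≠ 0 := by rintro rfl; simp at hr
      obtain ⟨i, hi⟩ := Finsupp.ne_iff.1 this
      obtain ⟨r', rfl⟩ := exists_split r i hi
      exact ⟨i, r', rfl, by simpa using hr⟩
    obtain ⟨i, r', rfl, hr'⟩ := h1 r hr
    obtain ⟨j, c', rfl, hc'⟩ := h1 c hc
    obtain ⟨m, hm1, hm2⟩ := ih r' c' hr' hc'
    exact ⟨m + ee i j, by rw [rowS_add, hm1, rowS_ee], by rw [colS_add, hm2, colS_ee]⟩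

lemma rowS_apply {n : ℕ} (m : Fin n × Fin n →₀ ℕ) (i : Fin n) : rowS m i = ∑ j, m (i, j) := by
  induction m using Finsupp.induction_linear with
  | zero => simp [rowS]
  | add f g hf hg => simp [rowS_add, hf, hg, Finset.sum_add_distrib]
  | single a b =>
    obtain ⟨a1, a2⟩ := a
    simp only [rowS, Finsupp.mapDomain_single, Finsupp.single_apply, Prod.mk.injEq]
    by_cases h : a1 = i <;> simp [h]

lemma colS_apply {n : ℕ} (m : Fin n × Fin n →₀ ℕ) (j : Fin n) : colS m j = ∑ i, m (i, j) := by
  induction m using Finsupp.induction_linear with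
  | zero => simp [colS]
  | add f g hf hg => simp [colS_add, hf, hg, Finset.sum_add_distrib]
  | single a b =>
    obtain ⟨a1, a2⟩ := a
    simp only [colS, Finsupp.mapDomain_single, Finsupp.single_apply, Prod.mk.injEq]
    by_cases h : a2 = j <;> simp [h]

/-- connectivity -/
lemma conn {n : ℕ} (t : ℕ) : ∀ (m m' : Fin n × Fin n →₀ ℕ), m'.degree = t →
    rowS m = rowS m' → colS m = colS m' →
    ∃ ε : ℂ, (monomial m 1 - monomial m' ε : MvPolynomial (Fin n × Fin n) ℂ) ∈ permIdeal n 2 := by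
  induction t with
  | zero =>
    intro m m' h hr hc
    have hm : m.degree = 0 := by
      rw [← Finsupp.degree_mapDomain Prod.fst m]
      change (rowS m).degree = 0
      rw [hr, rowS, Finsupp.degree_mapDomain, h]
    rw [Finsupp.degree_eq_zero_iff] at h hm
    subst h hm
    exact ⟨1, by simp⟩
  | succ t ih =>
    intro m m' h hr hc
    have : m' ≠ 0 := by rintro rfl; simp at h
    obtain ⟨⟨i, j⟩, hij⟩ := Finsupp.ne_iff.1 this
    obtain ⟨v', rfl⟩ := exists_split m' _ hij
    have hv' : v'.degree = t := by simpa using h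
    have key : ∀ v : Fin n × Fin n →₀ ℕ, rowS (v + ee i j) = rowS (v' + ee i j) →
        colS (v + ee i j) = colS (v' + ee i j) → ∃ ε : ℂ,
        (monomial (v + ee i j) 1 - monomial (v' + ee i j) ε : MvPolynomial (Fin n × Fin n) ℂ)
          ∈ permIdeal n 2 := by
      intro v h1 h2
      simp only [rowS_add, colS_add] at h1 h2
      obtain ⟨ε, hε⟩ := ih v v' hv' (add_right_cancel h1) (add_right_cancel h2)
      refine ⟨ε, ?_⟩
      rw [mon_ee, mon_ee, ← sub_mul]
      exact Ideal.mul_mem_right _ _ hε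
    by_cases hm : m (i, j) = 0
    · have hri : rowS m i ≠ 0 := by rw [hr, rowS_add, rowS_ee]; simp
      have hcj : colS m j ≠ 0 := by rw [hc, colS_add, colS_ee]; simp
      rw [rowS_apply] at hri
      rw [colS_apply] at hcj
      obtain ⟨l, -, hl⟩ := Finset.exists_ne_zero_of_sum_ne_zero hri
      obtain ⟨k, -, hk⟩ := Finset.exists_ne_zero_of_sum_ne_zero hcj
      have hjl : j ≠ l := by rintro rfl; exact hl hm
      have hik : i ≠ k := by rintro rfl; exact hk hm
      obtain ⟨u, rfl⟩ := exists_split m _ hl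
      have hk' : u (k, j) ≠ 0 := by
        simpa [Finsupp.single_apply, hik, hjl] using hk
      obtain ⟨w, rfl⟩ := exists_split u _ hk'
      have hsw := swap_mon w hik hjl
      have e1 : w + ee k j + ee i l = w + ee i l + ee k j := by abel
      have e2 : w + ee i j + ee k l = w + ee k l + ee i j := by abel
      change rowS (w + ee k j + ee i l) = _ at hr
      change colS (w + ee k j + ee i l) = _ at hc
      obtain ⟨ε, hε⟩ := key (w + ee k l)
        (by rw [← hr]; simp only [rowS_add, rowS_ee])
        (by rw [← hc]; simp only [colS_add, colS_ee]; abel)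
      refine ⟨-ε, ?_⟩
      change (monomial (w + ee k j + ee i l) 1 - _ : MvPolynomial (Fin n × Fin n) ℂ) ∈ _
      rw [e1]
      rw [e2] at hsw
      have := Ideal.sub_mem _ hsw hε
      convert this using 1
      rw [map_neg]
      ring
    · obtain ⟨v, rfl⟩ := exists_split m _ hm
      exact key v hr hc

/-- The coordinate functional. -/
noncomputable def phi {n : ℕ} (r c : Fin n →₀ ℕ) (a b : Fin n) :
    MvPolynomial (Fin n × Fin n) ℂ →ₗ[ℂ] ℂ :=
  (basisMonomials (Fin n × Fin n) ℂ).constr ℂ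
    (fun m => if rowS m = r ∧ colS m = c then (-1 : ℂ) ^ (m (a, b)) else 0)

lemma phi_monomial {n : ℕ} (r c : Fin n →₀ ℕ) (a b : Fin n) (m : Fin n × Fin n →₀ ℕ) (x : ℂ) :
    phi r c a b (monomial m x) =
      x * (if rowS m = r ∧ colS m = c then (-1 : ℂ) ^ (m (a, b)) else 0) := by
  have h : (monomial m x : MvPolynomial (Fin n × Fin n) ℂ) =
      x • basisMonomials (Fin n × Fin n) ℂ m := by
    rw [coe_basisMonomials, smul_monomial, smul_eq_mul, mul_one]
  rw [h, map_smul, phi, Module.Basis.constr_basis, smul_eq_mul]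

def IsGood {n : ℕ} (r c : Fin n →₀ ℕ) : Prop :=
  r.support.card = 1 ∨ c.support.card = 1 ∨ (r.support.card = 2 ∧ c.support.card = 2)

lemma phi_swap {n : ℕ} (r c : Fin n →₀ ℕ) (a b : Fin n) (hg : IsGood r c)
    (ha : a ∈ r.support) (hb : b ∈ c.support) {i k j l : Fin n} (u : Fin n × Fin n →₀ ℕ)
    (hik : i ≠ k) (hjl : j ≠ l) (x : ℂ) :
    phi r c a b (monomial (u + ee i j + ee k l) x) +
      phi r c a b (monomial (u + ee i l + ee k j) x) = 0 := by
  rw [phi_monomial, phi_monomial]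
  have e1 : rowS (u + ee i l + ee k j) = rowS (u + ee i j + ee k l) := by
    simp only [rowS_add, rowS_ee]
  have e2 : colS (u + ee i l + ee k j) = colS (u + ee i j + ee k l) := by
    simp only [colS_add, colS_ee]; abel
  rw [e1, e2]
  split_ifs with h
  · obtain ⟨h1, h2⟩ := h
    have hi : i ∈ r.support := by rw [← h1]; simp [rowS_add, rowS_ee]
    have hk : k ∈ r.support := by rw [← h1]; simp [rowS_add, rowS_ee]
    have hj : j ∈ c.support := by rw [← h2]; simp [colS_add, colS_ee]
    have hl : l ∈ c.support := by rw [← h2]; simp [colS_add, colS_ee]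
    have c1 : r.support.card ≠ 1 := fun h => hik (Finset.card_le_one.1 h.le _ hi _ hk)
    have c2 : c.support.card ≠ 1 := fun h => hjl (Finset.card_le_one.1 h.le _ hj _ hl)
    obtain h | h | ⟨h3, h4⟩ := hg
    · exact absurd h c1
    · exact absurd h c2
    · have hr : r.support = {i, k} := by
        symm; apply Finset.eq_of_subset_of_card_le
        · intro z; simp only [Finset.mem_insert, Finset.mem_singleton]
          rintro (rfl | rfl) <;> assumption
        · rw [h3, Finset.card_pair hik]
      have hc : c.support = {j, l} := by
        symm; apply Finset.eq_of_subset_of_card_le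
        · intro z; simp only [Finset.mem_insert, Finset.mem_singleton]
          rintro (rfl | rfl) <;> assumption
        · rw [h4, Finset.card_pair hjl]
      rw [hr] at ha
      rw [hc] at hb
      simp only [Finset.mem_insert, Finset.mem_singleton] at ha hb
      rcases ha with rfl | rfl <;> rcases hb with rfl | rfl <;>
        simp [hik, hjl, hik.symm, hjl.symm, pow_succ]
  · simp

lemma phi_ideal {n : ℕ} (r c : Fin n →₀ ℕ) (a b : Fin n) (hg : IsGood r c)
    (ha : a ∈ r.support) (hb : b ∈ c.support) (p : MvPolynomial (Fin n × Fin n) ℂ)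
    (hp : p ∈ permIdeal n 2) : phi r c a b p = 0 := by
  suffices h : ∀ q, phi r c a b (q * p) = 0 by simpa using h 1
  unfold permIdeal at hp
  induction hp using Submodule.span_induction with
  | mem x hx =>
    obtain ⟨R, C, hR, hC, rfl⟩ := hx
    intro q
    rw [subPerm_two]
    have h1 : (R.orderIsoOfFin hR 0 : Fin n) ≠ (R.orderIsoOfFin hR 1 : Fin n) := by
      intro h
      have := (R.orderIsoOfFin hR).injective (Subtype.ext h)
      simp at this
    have h2 : (C.orderIsoOfFin hC 0 : Fin n) ≠ (C.orderIsoOfFin hC 1 : Fin n) := by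
      intro h
      have := (C.orderIsoOfFin hC).injective (Subtype.ext h)
      simp at this
    induction q using MvPolynomial.induction_on' with
    | monomial u x =>
      rw [mul_add, ← mul_assoc, ← mul_assoc, ← mon_ee, ← mon_ee, ← mon_ee, ← mon_ee, map_add]
      exact phi_swap r c a b hg ha hb u h1 h2 x
    | add p q hp hq => rw [add_mul, map_add, hp, hq, add_zero]
  | zero => simp
  | add x y _ _ hx hy => intro q; rw [mul_add, map_add, hx, hy, add_zero]
  | smul s x _ hx => intro q; rw [smul_eq_mul, ← mul_assoc]; exact hx _

lemma exists_two_le {n t : ℕ} (r : Fin n →₀ ℕ) (h : r.degree = t) (ht : n < t) :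
    ∃ i, 2 ≤ r i := by
  by_contra! hc
  rw [Finsupp.degree_eq_sum] at h
  have : ∑ i, r i ≤ ∑ i : Fin n, 1 := Finset.sum_le_sum (fun i _ => by have := hc i; omega)
  simp at this
  omega

lemma split3 {n : ℕ} (c : Fin n →₀ ℕ) (h : 3 ≤ c.support.card) :
    ∃ x y z c', x ≠ y ∧ x ≠ z ∧ y ≠ z ∧ c = c' + dd x + dd y + dd z := by
  obtain ⟨s, hs, hsc⟩ := Finset.exists_subset_card_eq h
  obtain ⟨x, y, z, hxy, hxz, hyz, rfl⟩ := Finset.card_eq_three.1 hsc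
  have hx : c x ≠ 0 := by simpa using hs (by simp : x ∈ _)
  have hy : c y ≠ 0 := by simpa using hs (by simp : y ∈ _)
  have hz : c z ≠ 0 := by simpa using hs (by simp : z ∈ _)
  obtain ⟨c1, rfl⟩ := exists_split c z hz
  obtain ⟨c2, rfl⟩ := exists_split c1 y (by simpa [Finsupp.single_apply, hyz.symm] using hy)
  obtain ⟨c3, rfl⟩ := exists_split c2 x
    (by simpa [Finsupp.single_apply, hxz.symm, hxy.symm] using hx)
  exact ⟨x, y, z, c3, hxy, hxz, hyz, rfl⟩

lemma split21 {n t : ℕ} (r : Fin n →₀ ℕ) (h : r.degree = t) (ht : n < t)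
    (h2 : 2 ≤ r.support.card) :
    ∃ i k r', i ≠ k ∧ r = r' + dd i + dd i + dd k := by
  obtain ⟨i, hi⟩ := exists_two_le r h ht
  obtain ⟨k, hk, hki⟩ := Finset.exists_mem_ne (by omega : 1 < r.support.card) i
  obtain ⟨r1, rfl⟩ := exists_split r k (by simpa using hk)
  have hi1 : 2 ≤ r1 i := by simpa [Finsupp.single_apply, hki] using hi
  obtain ⟨r2, rfl⟩ := exists_split r1 i (by omega)
  obtain ⟨r3, rfl⟩ := exists_split r2 i (by simp at hi1; omega)
  exact ⟨i, k, r3, hki.symm, rfl⟩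

lemma deg_row {n : ℕ} (m : Fin n × Fin n →₀ ℕ) : (rowS m).degree = m.degree :=
  Finsupp.degree_mapDomain _ _
lemma deg_col {n : ℕ} (m : Fin n × Fin n →₀ ℕ) : (colS m).degree = m.degree :=
  Finsupp.degree_mapDomain _ _

lemma bad_of {n : ℕ} (m m' : Fin n × Fin n →₀ ℕ) (h1 : rowS m = rowS m') (h2 : colS m = colS m')
    (h : (monomial m' 1 : MvPolynomial (Fin n × Fin n) ℂ) ∈ permIdeal n 2) :
    (monomial m 1 : MvPolynomial (Fin n × Fin n) ℂ) ∈ permIdeal n 2 := by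
  obtain ⟨ε, hε⟩ := conn _ m m' rfl h1 h2
  have := Ideal.add_mem _ hε (Ideal.mul_mem_left _ (C ε) h)
  rwa [C_mul_monomial, mul_one, sub_add_cancel] at this

lemma bad_mem {n t : ℕ} (m : Fin n × Fin n →₀ ℕ) (hm : m.degree = t) (ht : n < t)
    (hb : ¬ IsGood (rowS m) (colS m)) :
    (monomial m 1 : MvPolynomial (Fin n × Fin n) ℂ) ∈ permIdeal n 2 := by
  have hr := (deg_row m).trans hm
  have hc := (deg_col m).trans hm
  have hr0 : (rowS m).support.card ≠ 0 := by
    intro h; rw [Finset.card_eq_zero, Finsupp.support_eq_empty] at h; rw [h] at hr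
    simp at hr; omega
  have hc0 : (colS m).support.card ≠ 0 := by
    intro h; rw [Finset.card_eq_zero, Finsupp.support_eq_empty] at h; rw [h] at hc
    simp at hc; omega
  unfold IsGood at hb
  have hcase : (2 ≤ (rowS m).support.card ∧ 3 ≤ (colS m).support.card) ∨
    (3 ≤ (rowS m).support.card ∧ 2 ≤ (colS m).support.card) := by omega
  rcases hcase with ⟨h1, h2⟩ | ⟨h1, h2⟩
  · obtain ⟨i, k, r', hik, hr'⟩ := split21 _ hr ht h1
    obtain ⟨x, y, z, c', hxy, hxz, hyz, hc'⟩ := split3 _ h2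
    obtain ⟨u, hu1, hu2⟩ := exists_marg r'.degree r' c' rfl (by
      rw [hr'] at hr; rw [hc'] at hc; simp at hr hc; omega)
    refine bad_of m (u + ee i x + ee i y + ee k z) ?_ ?_ (triple_row u hik hxy hxz hyz)
    · simp only [rowS_add, rowS_ee, hu1, hr']
    · simp only [colS_add, colS_ee, hu2, hc']
  · obtain ⟨i, k, c', hik, hc'⟩ := split21 _ hc ht h2
    obtain ⟨x, y, z, r', hxy, hxz, hyz, hr'⟩ := split3 _ h1
    obtain ⟨u, hu1, hu2⟩ := exists_marg r'.degree r' c' rfl (by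
      rw [hr'] at hr; rw [hc'] at hc; simp at hr hc; omega)
    refine bad_of m (u + ee x i + ee y i + ee z k) ?_ ?_ (triple_col u hik hxy hxz hyz)
    · simp only [rowS_add, rowS_ee, hu1, hr']
    · simp only [colS_add, colS_ee, hu2, hc']

open scoped Classical in
noncomputable def goodSet (n t : ℕ) : Finset ((Fin n →₀ ℕ) × (Fin n →₀ ℕ)) :=
  (Finset.univ.finsuppAntidiag t ×ˢ Finset.univ.finsuppAntidiag t).filter
    (fun x => IsGood x.1 x.2)

lemma mem_goodSet {n t : ℕ} (x : (Fin n →₀ ℕ) × (Fin n →₀ ℕ)) :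
    x ∈ goodSet n t ↔ x.1.degree = t ∧ x.2.degree = t ∧ IsGood x.1 x.2 := by
  simp [goodSet, Finsupp.degree_eq_sum, and_assoc]

lemma finrank_eq (n t : ℕ) (ht : n < t) :
    Module.finrank ℂ
        (↥(homogeneousSubmodule (Fin n × Fin n) ℂ t) ⧸
          Submodule.comap (homogeneousSubmodule (Fin n × Fin n) ℂ t).subtype
            (Submodule.restrictScalars ℂ (permIdeal n 2))) = (goodSet n t).card := by
  have hne : ∀ r : Fin n →₀ ℕ, r.degree = t → ∃ i, i ∈ r.support := by
    intro r hr
    have : r ≠ 0 := by rintro rfl; simp at hr; omega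
    simpa using Finsupp.ne_iff.1 this
  have h1 : ∀ μ : goodSet n t, ∃ i, i ∈ μ.1.1.support := fun μ => hne _ ((mem_goodSet _).1 μ.2).1
  have h2 : ∀ μ : goodSet n t, ∃ i, i ∈ μ.1.2.support := fun μ => hne _ ((mem_goodSet _).1 μ.2).2.1
  have h3 : ∀ μ : goodSet n t, IsGood μ.1.1 μ.1.2 := fun μ => ((mem_goodSet _).1 μ.2).2.2
  have h4 : ∀ μ : goodSet n t, ∃ m : Fin n × Fin n →₀ ℕ, rowS m = μ.1.1 ∧ colS m = μ.1.2 :=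
    fun μ => exists_marg t _ _ ((mem_goodSet _).1 μ.2).1 ((mem_goodSet _).1 μ.2).2.1
  choose a ha using h1
  choose b hb using h2
  choose ρ hρ1 hρ2 using h4
  have hρdeg : ∀ μ, (ρ μ).degree = t := fun μ => by
    rw [← deg_row, hρ1]; exact ((mem_goodSet _).1 μ.2).1
  let Φ : MvPolynomial (Fin n × Fin n) ℂ →ₗ[ℂ] (goodSet n t → ℂ) :=
    LinearMap.pi (fun μ => phi μ.1.1 μ.1.2 (a μ) (b μ))
  have hΦ : ∀ p μ, Φ p μ = phi μ.1.1 μ.1.2 (a μ) (b μ) p := fun p μ => rfl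
  have hΦI : ∀ p ∈ permIdeal n 2, Φ p = 0 := fun p hp => funext fun μ =>
    phi_ideal _ _ _ _ (h3 μ) (ha μ) (hb μ) p hp
  have hpow : ∀ k : ℕ, ((-1 : ℂ) ^ k) * (-1) ^ k = 1 := fun k => by
    rw [← mul_pow]; simp
  -- signed representatives
  let g : goodSet n t → MvPolynomial (Fin n × Fin n) ℂ := fun μ =>
    monomial (ρ μ) ((-1 : ℂ) ^ (ρ μ (a μ, b μ)))
  have hg : ∀ μ, g μ ∈ homogeneousSubmodule (Fin n × Fin n) ℂ t := fun μ =>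
    isHomogeneous_monomial _ (hρdeg μ)
  classical
  have hΦg : ∀ μ, Φ (g μ) = Pi.single μ 1 := by
    intro μ
    funext ν
    rw [hΦ, phi_monomial, hρ1, hρ2]
    by_cases h : ν = μ
    · subst h; simp [hpow]
    · rw [if_neg, Pi.single_eq_of_ne h, mul_zero]
      rintro ⟨h5, h6⟩
      exact h (Subtype.ext (Prod.ext h5 h6)).symm
  have hmon : ∀ m : Fin n × Fin n →₀ ℕ, m.degree = t →
      (monomial m 1 - ∑ μ, Φ (monomial m 1) μ • g μ : MvPolynomial (Fin n × Fin n) ℂ)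
        ∈ permIdeal n 2 := by
    intro m hm
    by_cases hgood : IsGood (rowS m) (colS m)
    · let μ : goodSet n t := ⟨(rowS m, colS m), (mem_goodSet _).2
        ⟨(deg_row m).trans hm, (deg_col m).trans hm, hgood⟩⟩
      obtain ⟨ε, hε⟩ := conn _ m (ρ μ) rfl (hρ1 μ).symm (hρ2 μ).symm
      have e : (monomial (ρ μ) ε : MvPolynomial (Fin n × Fin n) ℂ) =
          (ε * (-1 : ℂ) ^ (ρ μ (a μ, b μ))) • g μ := by
        rw [smul_monomial, smul_eq_mul, mul_assoc, hpow, mul_one]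
      rw [e] at hε
      have h0 := hΦI _ hε
      rw [map_sub, map_smul, hΦg, sub_eq_zero] at h0
      rw [h0, Finset.sum_eq_single μ]
      · simpa using hε
      · intro ν _ hν
        simp [hν]
      · simp
    · have := bad_mem m hm ht hgood
      rw [hΦI _ this]
      simpa using this
  have hall : ∀ p ∈ homogeneousSubmodule (Fin n × Fin n) ℂ t,
      p - ∑ μ, Φ p μ • g μ ∈ permIdeal n 2 := by
    intro p hp
    let L : MvPolynomial (Fin n × Fin n) ℂ →ₗ[ℂ] MvPolynomial (Fin n × Fin n) ℂ :=
      LinearMap.id - ∑ μ, ((LinearMap.proj μ).comp Φ).smulRight (g μ)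
    have hL : ∀ p, L p = p - ∑ μ, Φ p μ • g μ := fun p => by
      simp [L]
    rw [← hL]
    have : p ∈ Submodule.comap L (Submodule.restrictScalars ℂ (permIdeal n 2)) := by
      rw [p.as_sum]
      refine Submodule.sum_mem _ (fun m hm => ?_)
      have hd : m.degree = t := by
        have := hp (mem_support_iff.1 hm)
        rw [Finsupp.degree_eq_weight_one]; exact this
      have e : (monomial m (coeff m p) : MvPolynomial (Fin n × Fin n) ℂ) =
          (coeff m p) • monomial m 1 := by rw [smul_monomial, smul_eq_mul, mul_one]
      rw [e]
      refine Submodule.smul_mem _ _ ?_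
      rw [Submodule.mem_comap, hL]
      exact hmon m hd
    exact this
  let Ψ := Φ.comp (homogeneousSubmodule (Fin n × Fin n) ℂ t).subtype
  have hker : LinearMap.ker Ψ = Submodule.comap (homogeneousSubmodule (Fin n × Fin n) ℂ t).subtype
            (Submodule.restrictScalars ℂ (permIdeal n 2)) := by
    ext ⟨p, hp⟩
    constructor
    · intro h
      have h' : Φ p = 0 := h
      have := hall p hp
      rw [h'] at this
      simpa using this
    · intro h
      exact hΦI p h
  have hsurj : Function.Surjective Ψ := by
    intro v
    refine ⟨⟨∑ μ, v μ • g μ, Submodule.sum_mem _ fun μ _ => Submodule.smul_mem _ _ (hg μ)⟩, ?_⟩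
    change Φ (∑ μ, v μ • g μ) = v
    rw [map_sum]
    simp only [map_smul, hΦg]
    funext ν
    simp [Pi.single_apply]
  rw [← hker, (Ψ.quotKerEquivOfSurjective hsurj).finrank_eq]
  simp

lemma card_A1 (n t : ℕ) (ht : 0 < t) :
    ((Finset.univ.finsuppAntidiag t : Finset (Fin n →₀ ℕ)).filter
      (fun r => r.support.card = 1)).card = n := by
  classical
  have : (Finset.univ.finsuppAntidiag t : Finset (Fin n →₀ ℕ)).filter
      (fun r => r.support.card = 1) = Finset.univ.image (fun i => Finsupp.single i t) := by
    ext r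
    simp only [Finset.mem_filter, Finset.mem_finsuppAntidiag, Finset.subset_univ, and_true,
      Finset.mem_image, Finset.mem_univ, true_and]
    rw [← Finsupp.degree_eq_sum]
    constructor
    · rintro ⟨h1, h2⟩
      obtain ⟨i, b, hb, rfl⟩ := Finsupp.card_support_eq_one'.1 h2
      exact ⟨i, by simp at h1; rw [h1]⟩
    · rintro ⟨i, rfl⟩
      refine ⟨by simp, ?_⟩
      rw [Finsupp.support_single _ (by omega), Finset.card_singleton]
  rw [this, Finset.card_image_of_injective, Finset.card_univ, Fintype.card_fin]
  exact Finsupp.single_left_injective (by omega)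

lemma card_A2 (n t : ℕ) :
    ((Finset.univ.finsuppAntidiag t : Finset (Fin n →₀ ℕ)).filter
      (fun r => r.support.card = 2)).card = n.choose 2 * (t - 1) := by
  classical
  rw [Finset.card_eq_sum_card_fiberwise (f := Finsupp.support)
    (t := Finset.powersetCard 2 Finset.univ)]
  · rw [Finset.sum_const_nat (m := t - 1)]
    · simp
    · intro s hs
      rw [Finset.mem_powersetCard] at hs
      obtain ⟨i, j, hij, rfl⟩ := Finset.card_eq_two.1 hs.2
      symm
      rw [← Nat.card_Ico]
      refine Finset.card_bij (fun k _ => Finsupp.single i k + Finsupp.single j (t - k)) ?_ ?_ ?_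
      · intro k hk
        rw [Finset.mem_Ico] at hk
        have hsupp : (Finsupp.single i k + Finsupp.single j (t - k)).support = {i, j} := by
          ext x
          simp only [Finsupp.mem_support_iff, Finsupp.add_apply, Finsupp.single_apply,
            Finset.mem_insert, Finset.mem_singleton]
          by_cases h1 : i = x <;> by_cases h2 : j = x <;> simp [h1, h2, eq_comm] <;> grind
        simp only [Finset.mem_filter, Finset.mem_finsuppAntidiag, Finset.subset_univ, and_true,
          hsupp, Finset.card_pair hij]
        rw [← Finsupp.degree_eq_sum]
        rw [map_add, Finsupp.degree_single, Finsupp.degree_single]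
        omega
      · intro k hk k' hk' h
        have := DFunLike.congr_fun h i
        simpa [Finsupp.single_apply, hij.symm] using this
      · intro r hr
        simp only [Finset.mem_filter, Finset.mem_finsuppAntidiag, Finset.subset_univ,
          and_true] at hr
        obtain ⟨⟨h1, h2⟩, h3⟩ := hr
        have hi : r i ≠ 0 := by rw [← Finsupp.mem_support_iff, h3]; simp
        have hj : r j ≠ 0 := by rw [← Finsupp.mem_support_iff, h3]; simp
        have hsum : r i + r j = t := by
          rw [← Finsupp.degree_eq_sum, Finsupp.degree_apply, h3, Finset.sum_pair hij] at h1
          exact h1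
        refine ⟨r i, by rw [Finset.mem_Ico]; omega, ?_⟩
        ext x
        simp only [Finsupp.add_apply, Finsupp.single_apply]
        by_cases hx : x ∈ r.support
        · rw [h3] at hx
          simp only [Finset.mem_insert, Finset.mem_singleton] at hx
          rcases hx with rfl | rfl
          · simp [hij.symm]
          · simp [hij]; omega
        · have hx0 : r x = 0 := by simpa using hx
          rw [h3] at hx
          simp only [Finset.mem_insert, Finset.mem_singleton, not_or] at hx
          rw [if_neg (Ne.symm hx.1), if_neg (Ne.symm hx.2), hx0, add_zero]
  · intro r hr
    have := (Finset.mem_filter.1 (Finset.mem_coe.1 hr)).2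
    simp [Finset.mem_powersetCard, this]

lemma card_F (n t : ℕ) (hn : 0 < n) (ht : 0 < t) :
    (Finset.univ.finsuppAntidiag t : Finset (Fin n →₀ ℕ)).card =
      ∑ i ∈ Finset.range n, n.choose (i + 1) * (t - 1).choose i := by
  obtain ⟨n, rfl⟩ : ∃ k, n = k + 1 := ⟨n - 1, by omega⟩
  obtain ⟨t, rfl⟩ : ∃ k, t = k + 1 := ⟨t - 1, by omega⟩
  rw [Finset.card_finsuppAntidiag_nat_eq_choose, Finset.card_univ, Fintype.card_fin,
    show n + 1 + (t + 1) - 1 = t + (n + 1) by omega,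
    ← Nat.choose_symm_of_eq_add (show t + (n + 1) = n + (t + 1) by omega),
    Nat.add_choose_eq, Finset.Nat.sum_antidiagonal_eq_sum_range_succ_mk]
  refine Finset.sum_congr rfl fun i hi => ?_
  rw [Finset.mem_range] at hi
  rw [Nat.add_sub_cancel, mul_comm]
  congr 1
  exact Nat.choose_symm_of_eq_add (by omega)

lemma card_goodSet (n t : ℕ) (ht : 0 < t) :
    ((goodSet n t).card : ℤ) =
      2 * n * (Finset.univ.finsuppAntidiag t : Finset (Fin n →₀ ℕ)).card - n ^ 2
        + (n.choose 2 * (t - 1 : ℕ)) ^ 2 := by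
  classical
  set F := (Finset.univ.finsuppAntidiag t : Finset (Fin n →₀ ℕ)) with hF
  have h1 := card_A1 n t ht
  have h2 := card_A2 n t
  rw [← hF] at h1 h2
  set A := F.filter (fun r => r.support.card = 1) with hA
  set B := F.filter (fun r => r.support.card = 2) with hB
  have hdec : goodSet n t = (A ×ˢ F ∪ F ×ˢ A) ∪ B ×ˢ B := by
    ext ⟨r, c⟩
    simp only [goodSet, ← hF, Finset.mem_filter, Finset.mem_union, Finset.mem_product, hA, hB,
      IsGood]
    by_cases hr : r ∈ F <;> by_cases hc : c ∈ F <;> simp [hr, hc, or_assoc]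
  have hdis : Disjoint (A ×ˢ F ∪ F ×ˢ A) (B ×ˢ B) := by
    rw [Finset.disjoint_left]
    rintro ⟨r, c⟩
    simp only [Finset.mem_filter, Finset.mem_union, Finset.mem_product, hA, hB]
    omega
  have hint : (A ×ˢ F) ∩ (F ×ˢ A) = A ×ˢ A := by
    ext ⟨r, c⟩
    simp only [Finset.mem_filter, Finset.mem_inter, Finset.mem_product, hA]
    by_cases hr : r ∈ F <;> by_cases hc : c ∈ F <;> simp [hr, hc]
  have hu := Finset.card_union_add_card_inter (A ×ˢ F) (F ×ˢ A)
  rw [hint] at hu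
  rw [hdec, Finset.card_union_of_disjoint hdis]
  simp only [Finset.card_product, h1, h2] at hu ⊢
  zify at hu
  push_cast
  linear_combination hu

/-- For `n ≥ 3`, `I = I^{perm_n,2}` and `t > n`, the dimension of the degree-`t` component
`S_t/(I ∩ S_t)` of `S/I` is `Σ_{i=0}^{n-1} f_i · C(t-1,i)`, where `f_0 = n²`,
`f_1 = C(n²,2) − C(n,2)²`, `f_2 = 2C(n,2)² + 2n·C(n,3)` and `f_i = 2n·C(n,i+1)` for
`3 ≤ i ≤ n−1`. -/
theorem hilbertPolynomial_perm_two_quotient (n : ℕ) (hn : 3 ≤ n) (f : ℕ → ℤ)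
    (hf0 : f 0 = (n : ℤ) ^ 2)
    (hf1 : f 1 = ((n ^ 2).choose 2 : ℤ) - (n.choose 2 : ℤ) ^ 2)
    (hf2 : f 2 = 2 * (n.choose 2 : ℤ) ^ 2 + 2 * (n : ℤ) * (n.choose 3 : ℤ))
    (hfi : ∀ i, 3 ≤ i → i ≤ n - 1 → f i = 2 * (n : ℤ) * (n.choose (i + 1) : ℤ))
    (t : ℕ) (ht : n < t) :
    (Module.finrank ℂ
        (↥(homogeneousSubmodule (Fin n × Fin n) ℂ t) ⧸
          Submodule.comap (homogeneousSubmodule (Fin n × Fin n) ℂ t).subtype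
            (Submodule.restrictScalars ℂ (permIdeal n 2))) : ℤ) =
      ∑ i ∈ Finset.range n, f i * ((t - 1).choose i : ℤ) := by
  rw [finrank_eq n t ht, card_goodSet n t (by omega), card_F n t (by omega) (by omega)]
  have hf : ∀ i ∈ Finset.range n, f i * ((t - 1).choose i : ℤ) =
      2 * n * (n.choose (i + 1) * (t - 1).choose i : ℤ)
      + ((if i = 0 then -(n : ℤ) ^ 2 else 0)
      + (if i = 1 then (n.choose 2 : ℤ) ^ 2 * (t - 1 : ℕ) else 0)
      + (if i = 2 then 2 * (n.choose 2 : ℤ) ^ 2 * ((t - 1).choose 2 : ℤ) else 0)) := by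
    intro i hi
    rw [Finset.mem_range] at hi
    have hch : ∀ k : ℕ, 2 * (k.choose 2 : ℤ) = k * (k - 1) := by
      intro k
      induction k with
      | zero => simp
      | succ k ih => rw [Nat.choose_succ_succ' k 1]; push_cast; simp; linear_combination ih
    match i, hi with
    | 0, _ => rw [hf0]; simp; ring
    | 1, _ =>
      rw [hf1]
      have e1 := hch n
      have e2 := hch (n ^ 2)
      push_cast at e2
      have e3 : ((n ^ 2).choose 2 : ℤ) = 2 * n * n.choose 2 + 2 * (n.choose 2 : ℤ) ^ 2 := by
        have : (2 : ℤ) * ((n ^ 2).choose 2 : ℤ) =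
            2 * (2 * n * n.choose 2 + 2 * (n.choose 2 : ℤ) ^ 2) := by
          linear_combination e2 - (2 * n + (2 * (n.choose 2 : ℤ) + n * (n - 1))) * e1
        linarith
      rw [e3]
      simp
      ring
    | 2, _ => rw [hf2]; simp; ring
    | i + 3, hi => rw [hfi (i + 3) (by omega) (by omega)]; simp; ring
  rw [Finset.sum_congr rfl hf, Finset.sum_add_distrib, ← Finset.mul_sum, Finset.sum_add_distrib,
    Finset.sum_add_distrib, Finset.sum_ite_eq', Finset.sum_ite_eq', Finset.sum_ite_eq',
    if_pos (by simp; omega), if_pos (by simp; omega), if_pos (by simp; omega)]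
  have h2 : 2 * ((t - 1).choose 2 : ℤ) = (t - 1 : ℕ) * ((t - 1 : ℕ) - 1) := by
    generalize t - 1 = k
    induction k with
    | zero => simp
    | succ k ih => rw [Nat.choose_succ_succ' k 1]; push_cast; simp; linear_combination ih
  push_cast
  linear_combination -(n.choose 2 : ℤ) ^ 2 * h2
end

section
/- Let n ≥ 3 and let I = I^{perm_n,2} be the ideal of S generated by all 2×2 sub-permanents of the generic n×n matrix. Define f_0 = n², f_1 = C(n²,2) − C(n,2)², f_2 = 2·C(n,2)² + 2n·C(n,3), and f_i = 2n·C(n,i+1) for 3 ≤ i ≤ n−1. Then for every integer t with 3 ≤ t ≤ n, the dimension of the degree-t homogeneous component of the quotient ring S/I equals C(n,t)² + Σ_{i=0}^{n−1} f_i · C(t−1, i). -/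
open MvPolynomial

namespace PermTwo

abbrev Mon (n : ℕ) := (Fin n × Fin n) →₀ ℕ

/-- elementary exponent -/
noncomputable def E {n : ℕ} (i j : Fin n) : Mon n := Finsupp.single (i, j) 1

noncomputable def rowM {n : ℕ} (m : Mon n) : Fin n →₀ ℕ := m.mapDomain Prod.fst
noncomputable def colM {n : ℕ} (m : Mon n) : Fin n →₀ ℕ := m.mapDomain Prod.snd

variable {n : ℕ}

@[simp] lemma rowM_add (m m' : Mon n) : rowM (m + m') = rowM m + rowM m' := Finsupp.mapDomain_add
@[simp] lemma colM_add (m m' : Mon n) : colM (m + m') = colM m + colM m' := Finsupp.mapDomain_add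
@[simp] lemma rowM_zero : rowM (0 : Mon n) = 0 := Finsupp.mapDomain_zero
@[simp] lemma colM_zero : colM (0 : Mon n) = 0 := Finsupp.mapDomain_zero
@[simp] lemma rowM_E (i j : Fin n) : rowM (E i j) = Finsupp.single i 1 := Finsupp.mapDomain_single
@[simp] lemma colM_E (i j : Fin n) : colM (E i j) = Finsupp.single j 1 := Finsupp.mapDomain_single
lemma degree_rowM (m : Mon n) : (rowM m).degree = m.degree := Finsupp.degree_mapDomain _ _
lemma degree_colM (m : Mon n) : (colM m).degree = m.degree := Finsupp.degree_mapDomain _ _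

lemma peel (m : Mon n) {i j : Fin n} (h : m (i, j) ≠ 0) : ∃ m', m = m' + E i j :=
  ⟨m - E i j, (Finsupp.sub_add_single_one_cancel h).symm⟩

lemma peel1 (r : Fin n →₀ ℕ) {i : Fin n} (h : r i ≠ 0) : ∃ r', r = r' + Finsupp.single i 1 :=
  ⟨r - Finsupp.single i 1, (Finsupp.sub_add_single_one_cancel h).symm⟩

lemma rowM_apply (m : Mon n) (i : Fin n) : rowM m i = ∑ j, m (i, j) := by
  induction m using Finsupp.induction_linear with
  | zero => simp
  | add f g hf hg => simp [hf, hg, Finset.sum_add_distrib]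
  | single p a =>
    obtain ⟨u, v⟩ := p
    simp only [rowM, Finsupp.mapDomain_single, Finsupp.single_apply, Prod.mk.injEq]
    by_cases h : u = i <;> simp [h]

lemma colM_apply (m : Mon n) (j : Fin n) : colM m j = ∑ i, m (i, j) := by
  induction m using Finsupp.induction_linear with
  | zero => simp
  | add f g hf hg => simp [hf, hg, Finset.sum_add_distrib]
  | single p a =>
    obtain ⟨u, v⟩ := p
    simp only [colM, Finsupp.mapDomain_single, Finsupp.single_apply, Prod.mk.injEq]
    by_cases h : v = j <;> simp [h]

lemma exists_row {m : Mon n} {i : Fin n} (h : rowM m i ≠ 0) : ∃ j, m (i, j) ≠ 0 := by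
  by_contra! hc
  exact h (by rw [rowM_apply]; simp [hc])

lemma exists_col {m : Mon n} {j : Fin n} (h : colM m j ≠ 0) : ∃ i, m (i, j) ≠ 0 := by
  by_contra! hc
  exact h (by rw [colM_apply]; simp [hc])

/-- existence of a table with given margins -/
lemma exists_table (d : ℕ) : ∀ (r c : Fin n →₀ ℕ), r.degree = d → c.degree = d →
    ∃ m : Mon n, rowM m = r ∧ colM m = c := by
  induction d with
  | zero =>
    intro r c hr hc
    rw [Finsupp.degree_eq_zero_iff] at hr hc
    exact ⟨0, by simp [hr], by simp [hc]⟩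
  | succ d ih =>
    intro r c hr hc
    have h1 : ∃ i, r i ≠ 0 := by
      by_contra! h
      have : r = 0 := Finsupp.ext h
      simp [this] at hr
    have h2 : ∃ i, c i ≠ 0 := by
      by_contra! h
      have : c = 0 := Finsupp.ext h
      simp [this] at hc
    obtain ⟨i, hi⟩ := h1
    obtain ⟨j, hj⟩ := h2
    obtain ⟨r, rfl⟩ := peel1 r hi
    obtain ⟨c, rfl⟩ := peel1 c hj
    simp only [map_add, Finsupp.degree_single] at hr hc
    obtain ⟨m, hm1, hm2⟩ := ih r c (by omega) (by omega)
    exact ⟨m + E i j, by simp [hm1], by simp [hm2]⟩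

/-- generator -/
noncomputable def gen (i k j l : Fin n) : MvPolynomial (Fin n × Fin n) ℂ :=
  X (i, j) * X (k, l) + X (i, l) * X (k, j)

lemma subPerm_two {R C : Finset (Fin n)} (hR : R.card = 2) (hC : C.card = 2) :
    subPerm hR hC = gen (R.orderIsoOfFin hR 0 : Fin n) (R.orderIsoOfFin hR 1)
      (C.orderIsoOfFin hC 0) (C.orderIsoOfFin hC 1) := by
  have : (Finset.univ : Finset (Equiv.Perm (Fin 2))) = {1, Equiv.swap 0 1} := by decide
  unfold subPerm gen
  rw [this, Finset.sum_insert (by decide), Finset.sum_singleton]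
  simp [Fin.prod_univ_two]

lemma gen_symm (i k j l : Fin n) : gen k i j l = gen i k j l := by unfold gen; ring
lemma gen_symm' (i k j l : Fin n) : gen i k l j = gen i k j l := by unfold gen; ring

lemma gen_mem {i k j l : Fin n} (hik : i ≠ k) (hjl : j ≠ l) : gen i k j l ∈ permIdeal n 2 := by
  wlog h1 : i < k generalizing i k
  · rw [← gen_symm]; exact this hik.symm (lt_of_le_of_ne (not_lt.mp h1) hik.symm)
  wlog h2 : j < l generalizing j l
  · rw [← gen_symm']; exact this hjl.symm (lt_of_le_of_ne (not_lt.mp h2) hjl.symm)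
  have key : ∀ {a b : Fin n} (hab : a < b) (h : ({a, b} : Finset (Fin n)).card = 2),
      ((({a, b} : Finset (Fin n)).orderIsoOfFin h 0 : Fin n) = a) ∧
      ((({a, b} : Finset (Fin n)).orderIsoOfFin h 1 : Fin n) = b) := by
    intro a b hab h
    have hlt : (({a, b} : Finset (Fin n)).orderIsoOfFin h 0 : Fin n) <
      (({a, b} : Finset (Fin n)).orderIsoOfFin h 1 : Fin n) := by
      have := (({a, b} : Finset (Fin n)).orderIsoOfFin h).strictMono (show (0 : Fin 2) < 1 by decide)
      exact this
    have m0 := (({a, b} : Finset (Fin n)).orderIsoOfFin h 0).2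
    have m1 := (({a, b} : Finset (Fin n)).orderIsoOfFin h 1).2
    simp only [Finset.mem_insert, Finset.mem_singleton] at m0 m1
    rcases m0 with m0 | m0 <;> rcases m1 with m1 | m1 <;> rw [m0, m1] at hlt ⊢
    · exact absurd hlt (lt_irrefl _)
    · exact ⟨rfl, rfl⟩
    · exact absurd hlt hab.asymm
    · exact absurd hlt (lt_irrefl _)
  apply Ideal.subset_span
  refine ⟨{i, k}, {j, l}, Finset.card_pair hik, Finset.card_pair hjl, ?_⟩
  rw [subPerm_two, (key h1 _).1, (key h1 _).2, (key h2 _).1, (key h2 _).2]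

lemma mem_permIdeal_kill (L : MvPolynomial (Fin n × Fin n) ℂ →ₗ[ℂ] ℂ)
    (hL : ∀ (m : Mon n) (i k j l : Fin n), i ≠ k → j ≠ l →
      L (monomial (m + E i j + E k l) 1) + L (monomial (m + E i l + E k j) 1) = 0)
    {p : MvPolynomial (Fin n × Fin n) ℂ} (hp : p ∈ permIdeal n 2) : L p = 0 := by
  have key : ∀ a, L (a * p) = 0 := by
    unfold permIdeal at hp
    induction hp using Submodule.span_induction with
    | mem x hx =>
      obtain ⟨R, C, hR, hC, rfl⟩ := hx
      intro a
      rw [subPerm_two]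
      have h1 : (R.orderIsoOfFin hR 0 : Fin n) ≠ R.orderIsoOfFin hR 1 := by
        intro h
        have := (R.orderIsoOfFin hR).injective (Subtype.ext h)
        exact absurd this (by decide)
      have h2 : (C.orderIsoOfFin hC 0 : Fin n) ≠ C.orderIsoOfFin hC 1 := by
        intro h
        have := (C.orderIsoOfFin hC).injective (Subtype.ext h)
        exact absurd this (by decide)
      generalize (R.orderIsoOfFin hR 0 : Fin n) = i at *
      generalize (R.orderIsoOfFin hR 1 : Fin n) = k at *
      generalize (C.orderIsoOfFin hC 0 : Fin n) = j at *
      generalize (C.orderIsoOfFin hC 1 : Fin n) = l at *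
      induction a using MvPolynomial.induction_on' with
      | monomial u a =>
        have := hL u i k j l h1 h2
        have e : monomial u a * gen i k j l =
            a • (monomial (u + E i j + E k l) 1 + monomial (u + E i l + E k j) 1) := by
          simp [gen, X, E, mul_add, monomial_mul, smul_monomial, add_assoc]
        rw [e, map_smul, map_add, this, smul_zero]
      | add p q hp hq => rw [add_mul, map_add, hp, hq, add_zero]
    | zero => simp
    | add x y _ _ hx hy => intro a; rw [mul_add, map_add, hx, hy, add_zero]
    | smul b x _ hx => intro a; rw [smul_eq_mul, ← mul_assoc]; exact hx _
  simpa using key 1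

lemma swap_mem (m : Mon n) {i k j l : Fin n} (hik : i ≠ k) (hjl : j ≠ l) :
    (monomial (m + E i j + E k l) 1 + monomial (m + E i l + E k j) 1 :
      MvPolynomial (Fin n × Fin n) ℂ) ∈ permIdeal n 2 := by
  have e : (monomial (m + E i j + E k l) 1 + monomial (m + E i l + E k j) 1 :
      MvPolynomial (Fin n × Fin n) ℂ) = monomial m 1 * gen i k j l := by
    simp [gen, X, E, mul_add, monomial_mul, add_assoc]
  rw [e]
  exact Ideal.mul_mem_left _ _ (gen_mem hik hjl)

/-- connectivity -/
lemma connected (d : ℕ) : ∀ (m m' : Mon n), m.degree = d → rowM m = rowM m' → colM m = colM m' →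
    ∃ s : ℂ, (monomial m 1 - C s * monomial m' 1 : MvPolynomial (Fin n × Fin n) ℂ)
      ∈ permIdeal n 2 := by
  induction d with
  | zero =>
    intro m m' h hr hc
    have h' : m'.degree = 0 := by rw [← degree_rowM, ← hr, degree_rowM, h]
    rw [Finsupp.degree_eq_zero_iff] at h h'
    exact ⟨1, by simp [h, h']⟩
  | succ d ih =>
    intro m m' h hr hc
    have h1 : ∃ p, m p ≠ 0 := by
      by_contra! hh
      have : m = 0 := Finsupp.ext hh
      simp [this] at h
    obtain ⟨⟨i, j⟩, hp⟩ := h1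
    obtain ⟨m, rfl⟩ := peel m hp
    have main : ∀ m'' : Mon n, rowM (m + E i j) = rowM (m'' + E i j) →
        colM (m + E i j) = colM (m'' + E i j) →
        ∃ s : ℂ, (monomial (m + E i j) 1 - C s * monomial (m'' + E i j) 1 :
          MvPolynomial (Fin n × Fin n) ℂ) ∈ permIdeal n 2 := by
      intro m'' hr hc
      rw [rowM_add, rowM_add] at hr
      rw [colM_add, colM_add] at hc
      have hd : m.degree = d := by
        have : (E i j : Mon n).degree = 1 := Finsupp.degree_single _ _
        rw [map_add, this] at h; omega
      obtain ⟨s, hs⟩ := ih m m'' hd (add_right_cancel hr) (add_right_cancel hc)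
      refine ⟨s, ?_⟩
      have := Ideal.mul_mem_right (X (i, j)) _ hs
      have e : ∀ q : Mon n, (monomial (q + E i j) 1 : MvPolynomial (Fin n × Fin n) ℂ)
          = monomial q 1 * X (i, j) := by
        intro q; simp [X, E, monomial_mul]
      rw [e, e, ← mul_assoc, ← sub_mul]
      exact this
    by_cases hij : m' (i, j) ≠ 0
    · obtain ⟨m'', rfl⟩ := peel m' hij
      exact main m'' hr hc
    · push Not at hij
      obtain ⟨l, hl⟩ := exists_row (m := m') (i := i) (by rw [← hr]; simp)
      have hjl : j ≠ l := by rintro rfl; exact hl hij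
      obtain ⟨m1, rfl⟩ := peel m' hl
      obtain ⟨k, hk⟩ := exists_col (m := m1 + E i l) (j := j) (by rw [← hc]; simp)
      have hik : i ≠ k := by rintro rfl; exact hk hij
      have hk' : m1 (k, j) ≠ 0 := by
        intro h0; apply hk
        simp [h0, E, hik]
      obtain ⟨m2, rfl⟩ := peel m1 hk'
      obtain ⟨s, hs⟩ := main (m2 + E k l) (by rw [hr]; simp) (by rw [hc]; simp; abel)
      refine ⟨-s, ?_⟩
      have hsw := swap_mem m2 hik hjl
      have e1 : m2 + E k l + E i j = m2 + E i j + E k l := by abel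
      have e2 : m2 + E k j + E i l = m2 + E i l + E k j := by abel
      rw [e1] at hs
      rw [e2]
      have := Ideal.add_mem _ hs (Ideal.mul_mem_left _ (C s) hsw)
      convert this using 1
      rw [C_neg]; ring

lemma triangle_row (m : Mon n) {i u j k l : Fin n} (hiu : i ≠ u) (hjk : j ≠ k) (hjl : j ≠ l)
    (hkl : k ≠ l) : (monomial (m + E i j + E i k + E u l) 1 :
      MvPolynomial (Fin n × Fin n) ℂ) ∈ permIdeal n 2 := by
  have h1 := swap_mem (m + E i j) hiu hkl
  have h2 := swap_mem (m + E i k) hiu hjl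
  have h3 := swap_mem (m + E i l) hiu hjk
  have e1 : m + E i k + E i j = m + E i j + E i k := by abel
  have e2 : m + E i l + E i j = m + E i j + E i l := by abel
  have e3 : m + E i l + E i k = m + E i k + E i l := by abel
  rw [e1] at h2
  rw [e2, e3] at h3
  have := Ideal.mul_mem_left _ (C (1/2 : ℂ)) (Ideal.sub_mem _ (Ideal.add_mem _ h1 h2) h3)
  convert this using 1
  have : (C (1/2 : ℂ) : MvPolynomial (Fin n × Fin n) ℂ) * 2 = 1 := by
    rw [← map_ofNat C 2, ← C_mul]; norm_num
  linear_combination (-monomial (m + E i j + E i k + E u l) 1) * this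

lemma triangle_col (m : Mon n) {i u j k l : Fin n} (hiu : i ≠ u) (hjk : j ≠ k) (hjl : j ≠ l)
    (hkl : k ≠ l) : (monomial (m + E j i + E k i + E l u) 1 :
      MvPolynomial (Fin n × Fin n) ℂ) ∈ permIdeal n 2 := by
  have h1 := swap_mem (m + E j i) hkl hiu
  have h2 := swap_mem (m + E k i) hjl hiu
  have h3 := swap_mem (m + E l i) hjk hiu
  have e1 : m + E k i + E j i = m + E j i + E k i := by abel
  have e2 : m + E j i + E k u + E l i = m + E l i + E j i + E k u := by abel
  have e3 : m + E k i + E j u + E l i = m + E l i + E j u + E k i := by abel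
  rw [e2] at h1
  rw [e1, e3] at h2
  have := Ideal.mul_mem_left _ (C (1/2 : ℂ)) (Ideal.sub_mem _ (Ideal.add_mem _ h1 h2) h3)
  convert this using 1
  have : (C (1/2 : ℂ) : MvPolynomial (Fin n × Fin n) ℂ) * 2 = 1 := by
    rw [← map_ofNat C 2, ← C_mul]; norm_num
  linear_combination (-monomial (m + E j i + E k i + E l u) 1) * this

lemma mem_of_same {m m' : Mon n} (hr : rowM m = rowM m') (hc : colM m = colM m')
    (h : (monomial m' 1 : MvPolynomial (Fin n × Fin n) ℂ) ∈ permIdeal n 2) :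
    (monomial m 1 : MvPolynomial (Fin n × Fin n) ℂ) ∈ permIdeal n 2 := by
  obtain ⟨s, hs⟩ := connected _ m m' rfl hr hc
  have := Ideal.add_mem _ hs (Ideal.mul_mem_left _ (C s) h)
  simpa using this

lemma three_margin (c : Fin n →₀ ℕ) (h : 3 ≤ c.support.card) : ∃ (j k l : Fin n) (c' : Fin n →₀ ℕ),
    j ≠ k ∧ j ≠ l ∧ k ≠ l ∧
    c = c' + Finsupp.single j 1 + Finsupp.single k 1 + Finsupp.single l 1 := by
  obtain ⟨j, k, l, hj, hk, hl, hjk, hjl, hkl⟩ := Finset.two_lt_card_iff.mp (show 2 < _ from h)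
  rw [Finsupp.mem_support_iff] at hj hk hl
  obtain ⟨c, rfl⟩ := peel1 c hl
  obtain ⟨c, rfl⟩ := peel1 c (i := k) (by simpa [Finsupp.single_apply, hkl.symm] using hk)
  obtain ⟨c, rfl⟩ := peel1 c (i := j) (by
    simpa [Finsupp.single_apply, hjk, hjk.symm, hjl.symm] using hj)
  exact ⟨j, k, l, c, hjk, hjl, hkl, rfl⟩

lemma two_margin (r : Fin n →₀ ℕ) (h : 2 ≤ r.support.card) (i : Fin n) (hi : 2 ≤ r i) :
    ∃ (u : Fin n) (r' : Fin n →₀ ℕ), i ≠ u ∧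
    r = r' + Finsupp.single i 1 + Finsupp.single i 1 + Finsupp.single u 1 := by
  obtain ⟨u, hu, hui⟩ := Finset.exists_mem_ne (show 1 < _ from h) i
  rw [Finsupp.mem_support_iff] at hu
  obtain ⟨r, rfl⟩ := peel1 r hu
  simp only [Finsupp.add_apply, Finsupp.single_apply, hui, if_false] at hi
  obtain ⟨r, rfl⟩ := peel1 r (i := i) (by omega)
  simp only [Finsupp.add_apply, Finsupp.single_apply, if_true] at hi
  obtain ⟨r, rfl⟩ := peel1 r (i := i) (by omega)
  exact ⟨u, r, hui.symm, rfl⟩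

lemma bad_row (m : Mon n) (hc : 3 ≤ (colM m).support.card) (hr : 2 ≤ (rowM m).support.card)
    (i : Fin n) (hi : 2 ≤ rowM m i) :
    (monomial m 1 : MvPolynomial (Fin n × Fin n) ℂ) ∈ permIdeal n 2 := by
  obtain ⟨j, k, l, c, hjk, hjl, hkl, hc⟩ := three_margin _ hc
  obtain ⟨u, r, hiu, hr⟩ := two_margin _ hr i hi
  have d1 : (rowM m).degree = (colM m).degree := by rw [degree_rowM, degree_colM]
  rw [hr, hc] at d1
  simp only [map_add, Finsupp.degree_single] at d1
  obtain ⟨m', h1, h2⟩ := exists_table r.degree r c rfl (by omega)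
  refine mem_of_same (m' := m' + E i j + E i k + E u l) ?_ ?_ (triangle_row m' hiu hjk hjl hkl)
  · simp [hr, h1]
  · simp [hc, h2]

lemma bad_col (m : Mon n) (hr : 3 ≤ (rowM m).support.card) (hc : 2 ≤ (colM m).support.card)
    (i : Fin n) (hi : 2 ≤ colM m i) :
    (monomial m 1 : MvPolynomial (Fin n × Fin n) ℂ) ∈ permIdeal n 2 := by
  obtain ⟨j, k, l, r, hjk, hjl, hkl, hr⟩ := three_margin _ hr
  obtain ⟨u, c, hiu, hc⟩ := two_margin _ hc i hi
  have d1 : (rowM m).degree = (colM m).degree := by rw [degree_rowM, degree_colM]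
  rw [hr, hc] at d1
  simp only [map_add, Finsupp.degree_single] at d1
  obtain ⟨m', h1, h2⟩ := exists_table r.degree r c rfl (by omega)
  refine mem_of_same (m' := m' + E j i + E k i + E l u) ?_ ?_ (triangle_col m' hiu hjk hjl hkl)
  · simp [hr, h1]
  · simp [hc, h2]

def Good (p : (Fin n →₀ ℕ) × (Fin n →₀ ℕ)) : Prop :=
  ((∀ i, p.1 i ≤ 1) ∧ (∀ j, p.2 j ≤ 1)) ∨ p.1.support.card = 1 ∨ p.2.support.card = 1 ∨
    (p.1.support.card = 2 ∧ p.2.support.card = 2)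

lemma degree_le_card (r : Fin n →₀ ℕ) (h : ∀ i, r i ≤ 1) : r.degree ≤ r.support.card := by
  rw [Finsupp.degree_apply]
  calc _ ≤ ∑ i ∈ r.support, 1 := Finset.sum_le_sum fun i _ => h i
    _ = _ := by simp

lemma bad_mem (m : Mon n) (t : ℕ) (ht : 3 ≤ t) (hm : m.degree = t)
    (hb : ¬ Good (rowM m, colM m)) :
    (monomial m 1 : MvPolynomial (Fin n × Fin n) ℂ) ∈ permIdeal n 2 := by
  unfold Good at hb
  simp only [not_or, not_and_or, not_forall, not_le] at hb
  obtain ⟨h1, h2, h3, h4⟩ := hb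
  have pos : ∀ r : Fin n →₀ ℕ, r.degree = t → r.support.card ≠ 0 := by
    intro r hr h0
    rw [Finset.card_eq_zero, Finsupp.support_eq_empty] at h0
    simp [h0] at hr; omega
  have dr : (rowM m).degree = t := by rw [degree_rowM, hm]
  have dc : (colM m).degree = t := by rw [degree_colM, hm]
  have p1 := pos _ dr
  have p2 := pos _ dc
  by_cases hA : ∃ i, 1 < rowM m i
  · by_cases hB : 3 ≤ (colM m).support.card
    · obtain ⟨i, hi⟩ := hA
      exact bad_row m hB (by omega) i hi
    · have : ∃ j, 1 < colM m j := by
        by_contra! hc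
        have := degree_le_card _ hc
        omega
      obtain ⟨j, hj⟩ := this
      exact bad_col m (by omega) (by omega) j hj
  · have hB := h1.resolve_left hA
    push Not at hA
    have := degree_le_card _ hA
    obtain ⟨j, hj⟩ := hB
    exact bad_col m (by omega) (by omega) j hj

lemma row_zero_entry {m : Mon n} {i : Fin n} (h : rowM m i = 0) (j : Fin n) : m (i, j) = 0 := by
  rw [rowM_apply, Finset.sum_eq_zero_iff] at h
  exact h j (Finset.mem_univ _)

lemma sum_single_01 (r : Fin n →₀ ℕ) (h : ∀ i, r i ≤ 1) :
    ∑ a : r.support, Finsupp.single (a : Fin n) 1 = r := by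
  rw [Finset.sum_coe_sort r.support (fun a => Finsupp.single a 1)]
  conv_rhs => rw [← Finsupp.sum_single r]
  unfold Finsupp.sum
  refine Finset.sum_congr rfl fun i hi => ?_
  have := h i
  rw [Finsupp.mem_support_iff] at hi
  rw [show r i = 1 by omega]

lemma card_support_01 (r : Fin n →₀ ℕ) (h : ∀ i, r i ≤ 1) : r.support.card = r.degree := by
  conv_rhs => rw [← sum_single_01 r h]
  simp

def IsSign (p : (Fin n →₀ ℕ) × (Fin n →₀ ℕ)) (ε : Mon n → ℂ) : Prop :=
  (∀ (m : Mon n) (i k j l : Fin n), i ≠ k → j ≠ l →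
    rowM (m + E i j + E k l) = p.1 → colM (m + E i j + E k l) = p.2 →
      ε (m + E i j + E k l) + ε (m + E i l + E k j) = 0) ∧
  ∃ m0, rowM m0 = p.1 ∧ colM m0 = p.2 ∧ ε m0 ≠ 0

lemma good_01 (p : (Fin n →₀ ℕ) × (Fin n →₀ ℕ)) (hd : p.1.degree = p.2.degree)
    (h1 : ∀ i, p.1 i ≤ 1) (h2 : ∀ j, p.2 j ≤ 1) : ∃ ε, IsSign p ε := by
  obtain ⟨r, c⟩ := p
  simp only at hd h1 h2
  have hcard : r.support.card = c.support.card := by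
    rw [card_support_01 r h1, card_support_01 c h2, hd]
  let e : r.support ≃ c.support := Finset.equivOfCardEq hcard
  refine ⟨fun m => Matrix.det (Matrix.of fun (a b : r.support) => (m ((a : Fin n), (e b : Fin n)) : ℂ)),
    ?_, ?_⟩
  · intro m i k j l hik hjl hr hc
    simp only at hr hc
    have hi : i ∈ r.support := by rw [← hr]; simp
    have hk : k ∈ r.support := by rw [← hr]; simp
    have zi : ∀ x, m (i, x) = 0 := by
      apply row_zero_entry
      have := h1 i
      rw [← hr] at this
      simp at this; omega
    have zk : ∀ x, m (k, x) = 0 := by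
      apply row_zero_entry
      have := h1 k
      rw [← hr] at this
      simp at this; omega
    have hne : (⟨i, hi⟩ : r.support) ≠ ⟨k, hk⟩ := fun h => hik (by simpa using h)
    have key : (Matrix.of fun (a b : r.support) =>
          (((m + E i l + E k j) ((a : Fin n), (e b : Fin n)) : ℕ) : ℂ)) =
        (Matrix.of fun (a b : r.support) =>
          (((m + E i j + E k l) ((a : Fin n), (e b : Fin n)) : ℕ) : ℂ)).submatrix
          (Equiv.swap ⟨i, hi⟩ ⟨k, hk⟩) id := by
      ext a b
      simp only [Matrix.of_apply, Matrix.submatrix_apply, id]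
      congr 1
      by_cases ha : a = ⟨i, hi⟩
      · subst ha
        simp [E, Finsupp.single_apply, zi, zk, hik, hik.symm]
      · by_cases ha' : a = ⟨k, hk⟩
        · subst ha'
          simp [E, Finsupp.single_apply, zi, zk, hik, hik.symm]
        · rw [Equiv.swap_apply_of_ne_of_ne ha ha']
          have g1 : i ≠ a := fun h => ha (Subtype.ext h.symm)
          have g2 : k ≠ a := fun h => ha' (Subtype.ext h.symm)
          simp [E, g1, g2]
    simp only
    rw [key, Matrix.det_permute, Equiv.Perm.sign_swap hne]
    simp
  · refine ⟨∑ a : r.support, E (a : Fin n) (e a : Fin n), ?_, ?_, ?_⟩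
    · simp only [rowM, Finsupp.mapDomain_finsetSum, E, Finsupp.mapDomain_single]
      exact sum_single_01 r h1
    · simp only [colM, Finsupp.mapDomain_finsetSum, E, Finsupp.mapDomain_single]
      rw [Equiv.sum_comp e (fun b => Finsupp.single (b : Fin n) 1)]
      exact sum_single_01 c h2
    · have : (Matrix.of fun (a b : r.support) =>
          (((∑ a : r.support, E (a : Fin n) (e a : Fin n)) ((a : Fin n), (e b : Fin n)) : ℕ) : ℂ))
          = 1 := by
        ext a b
        rw [Matrix.of_apply, Finsupp.finsetSum_apply, Matrix.one_apply]
        simp only [E, Finsupp.single_apply, Prod.mk.injEq]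
        rw [Finset.sum_eq_single a]
        · by_cases h : a = b <;> simp [h]
        · intro x _ hx
          rw [if_neg]
          rintro ⟨h, _⟩
          exact hx (Subtype.ext h)
        · simp
      simp only
      rw [this]; simp

lemma good_22 (p : (Fin n →₀ ℕ) × (Fin n →₀ ℕ)) (hd : p.1.degree = p.2.degree)
    (h1 : p.1.support.card = 2) (h2 : p.2.support.card = 2) : ∃ ε, IsSign p ε := by
  obtain ⟨a, b, hab, hs⟩ := Finset.card_eq_two.mp h1
  obtain ⟨e, f, hef, hs'⟩ := Finset.card_eq_two.mp h2
  refine ⟨fun m => (-1) ^ (m (a, e)), ?_, ?_⟩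
  · intro m i k j l hik hjl hr hc
    have hi : i ∈ p.1.support := by rw [← hr]; simp
    have hk : k ∈ p.1.support := by rw [← hr]; simp
    have hj : j ∈ p.2.support := by rw [← hc]; simp
    have hl : l ∈ p.2.support := by rw [← hc]; simp
    rw [hs, Finset.mem_insert, Finset.mem_singleton] at hi hk
    rw [hs', Finset.mem_insert, Finset.mem_singleton] at hj hl
    rcases hi with rfl | rfl <;> rcases hk with rfl | rfl <;> rcases hj with rfl | rfl <;>
      rcases hl with rfl | rfl <;>
      first
        | exact absurd rfl hik
        | exact absurd rfl hjl
        | simp [E, hik, hjl, hik.symm, hjl.symm, pow_succ]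
  · obtain ⟨m, h1, h2⟩ := exists_table _ p.1 p.2 hd rfl
    exact ⟨m, h1, h2, by simp⟩

lemma good_1r (p : (Fin n →₀ ℕ) × (Fin n →₀ ℕ)) (hd : p.1.degree = p.2.degree)
    (h1 : p.1.support.card = 1) : ∃ ε, IsSign p ε := by
  obtain ⟨a, hs⟩ := Finset.card_eq_one.mp h1
  refine ⟨fun m => 1, ?_, ?_⟩
  · intro m i k j l hik hjl hr hc
    have hi : i ∈ p.1.support := by rw [← hr]; simp
    have hk : k ∈ p.1.support := by rw [← hr]; simp
    rw [hs, Finset.mem_singleton] at hi hk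
    exact absurd (hi.trans hk.symm) hik
  · obtain ⟨m, h1, h2⟩ := exists_table _ p.1 p.2 hd rfl
    exact ⟨m, h1, h2, by simp⟩

lemma good_1c (p : (Fin n →₀ ℕ) × (Fin n →₀ ℕ)) (hd : p.1.degree = p.2.degree)
    (h1 : p.2.support.card = 1) : ∃ ε, IsSign p ε := by
  obtain ⟨a, hs⟩ := Finset.card_eq_one.mp h1
  refine ⟨fun m => 1, ?_, ?_⟩
  · intro m i k j l hik hjl hr hc
    have hi : j ∈ p.2.support := by rw [← hc]; simp
    have hk : l ∈ p.2.support := by rw [← hc]; simp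
    rw [hs, Finset.mem_singleton] at hi hk
    exact absurd (hi.trans hk.symm) hjl
  · obtain ⟨m, h1, h2⟩ := exists_table _ p.1 p.2 hd rfl
    exact ⟨m, h1, h2, by simp⟩

lemma good_sign (p : (Fin n →₀ ℕ) × (Fin n →₀ ℕ)) (hd : p.1.degree = p.2.degree) (h : Good p) :
    ∃ ε, IsSign p ε := by
  rcases h with ⟨h1, h2⟩ | h | h | ⟨h1, h2⟩
  · exact good_01 p hd h1 h2
  · exact good_1r p hd h
  · exact good_1c p hd h
  · exact good_22 p hd h1 h2

open Classical in
noncomputable def Lfun (p : (Fin n →₀ ℕ) × (Fin n →₀ ℕ)) (ε : Mon n → ℂ) :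
    MvPolynomial (Fin n × Fin n) ℂ →ₗ[ℂ] ℂ :=
  (basisMonomials (Fin n × Fin n) ℂ).constr ℂ
    (fun m => if rowM m = p.1 ∧ colM m = p.2 then ε m else 0)

open Classical in
lemma Lfun_monomial (p : (Fin n →₀ ℕ) × (Fin n →₀ ℕ)) (ε : Mon n → ℂ) (m : Mon n) :
    Lfun p ε (monomial m 1) = if rowM m = p.1 ∧ colM m = p.2 then ε m else 0 := by
  have : (monomial m 1 : MvPolynomial (Fin n × Fin n) ℂ) =
    basisMonomials (Fin n × Fin n) ℂ m := by simp
  rw [this, Lfun, Module.Basis.constr_basis]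

lemma Lfun_kill (p : (Fin n →₀ ℕ) × (Fin n →₀ ℕ)) (ε : Mon n → ℂ) (h : IsSign p ε)
    {q : MvPolynomial (Fin n × Fin n) ℂ} (hq : q ∈ permIdeal n 2) : Lfun p ε q = 0 := by
  refine mem_permIdeal_kill _ ?_ hq
  intro m i k j l hik hjl
  have e1 : rowM (m + E i l + E k j) = rowM (m + E i j + E k l) := by simp
  have e2 : colM (m + E i l + E k j) = colM (m + E i j + E k l) := by simp; abel
  rw [Lfun_monomial, Lfun_monomial, e1, e2]
  by_cases hh : rowM (m + E i j + E k l) = p.1 ∧ colM (m + E i j + E k l) = p.2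
  · rw [if_pos hh, if_pos hh]
    exact h.1 m i k j l hik hjl hh.1 hh.2
  · rw [if_neg hh, if_neg hh, add_zero]

theorem finrank_eq_card (t : ℕ) (ht : 3 ≤ t) (G : Finset ((Fin n →₀ ℕ) × (Fin n →₀ ℕ)))
    (hG : ∀ p, p ∈ G ↔ p.1.degree = t ∧ p.2.degree = t ∧ Good p) :
    Module.finrank ℂ
        (↥(homogeneousSubmodule (Fin n × Fin n) ℂ t) ⧸
          Submodule.comap (homogeneousSubmodule (Fin n × Fin n) ℂ t).subtype
            (Submodule.restrictScalars ℂ (permIdeal n 2))) = G.card := by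
  classical
  have hex : ∀ p : G, ∃ ε, IsSign p.1 ε := fun p => by
    have := (hG p.1).mp p.2
    exact good_sign _ (this.1.trans this.2.1.symm) this.2.2
  choose ε hε using hex
  choose m0 hr0 hc0 hne using fun p => (hε p).2
  let Φ : homogeneousSubmodule (Fin n × Fin n) ℂ t →ₗ[ℂ] (G → ℂ) :=
    (LinearMap.pi fun p => Lfun p.1 (ε p)) ∘ₗ (homogeneousSubmodule (Fin n × Fin n) ℂ t).subtype
  have hΦ : ∀ q p, Φ q p = Lfun p.1 (ε p) (q : MvPolynomial (Fin n × Fin n) ℂ) := fun _ _ => rfl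
  have hdeg0 : ∀ p, (m0 p).degree = t := fun p => by
    rw [← degree_rowM, hr0]; exact ((hG p.1).mp p.2).1
  have hL0 : ∀ p p' : G, Lfun p.1 (ε p) (monomial (m0 p') 1) = if p = p' then ε p (m0 p) else 0 := by
    intro p p'
    rw [Lfun_monomial, hr0, hc0]
    by_cases h : p = p'
    · subst h; simp
    · rw [if_neg h, if_neg]
      rintro ⟨h1, h2⟩
      exact h (Subtype.ext (Prod.ext h1.symm h2.symm))
  -- reduction
  let Ψ : MvPolynomial (Fin n × Fin n) ℂ →ₗ[ℂ] MvPolynomial (Fin n × Fin n) ℂ :=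
    ∑ p : G, ((ε p (m0 p))⁻¹ • (Lfun p.1 (ε p)).smulRight (monomial (m0 p) 1))
  have hΨ : ∀ q, Ψ q = ∑ p : G, (ε p (m0 p))⁻¹ • Lfun p.1 (ε p) q • monomial (m0 p) 1 := by
    intro q; simp [Ψ]
  have hmon : ∀ m : Mon n, m.degree = t → monomial m 1 - Ψ (monomial m 1) ∈ permIdeal n 2 := by
    intro m hm
    by_cases hg : Good (rowM m, colM m)
    · let p : G := ⟨(rowM m, colM m), (hG _).mpr ⟨by simpa [degree_rowM] using hm,
        by simpa [degree_colM] using hm, hg⟩⟩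
      obtain ⟨s, hs⟩ := connected _ m (m0 p) rfl (hr0 p).symm (hc0 p).symm
      have h1 := Lfun_kill p.1 (ε p) (hε p) hs
      rw [map_sub, ← smul_eq_C_mul, map_smul, hL0, if_pos rfl, sub_eq_zero] at h1
      have h2 : Ψ (monomial m 1) = C s * monomial (m0 p) 1 := by
        rw [hΨ, Finset.sum_eq_single p]
        · rw [h1, smul_smul, smul_eq_mul, mul_comm s, inv_mul_cancel_left₀ (hne p), smul_eq_C_mul]
        · intro p' _ hp'
          rw [Lfun_monomial, if_neg, zero_smul, smul_zero]
          rintro ⟨h1, h2⟩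
          exact hp' (Subtype.ext (Prod.ext h1.symm h2.symm))
        · simp
      rw [h2]; exact hs
    · have h2 : Ψ (monomial m 1) = 0 := by
        rw [hΨ]
        refine Finset.sum_eq_zero fun p _ => ?_
        rw [Lfun_monomial, if_neg, zero_smul, smul_zero]
        rintro ⟨h1, h2⟩
        apply hg
        rw [h1, h2]
        exact ((hG p.1).mp p.2).2.2
      rw [h2, sub_zero]
      exact bad_mem m t ht hm hg
  have hred : ∀ q ∈ homogeneousSubmodule (Fin n × Fin n) ℂ t, q - Ψ q ∈ permIdeal n 2 := by
    intro q hq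
    have hs : q = ∑ m ∈ q.support, coeff m q • monomial m 1 := by
      conv_lhs => rw [← support_sum_monomial_coeff q]
      simp [smul_monomial]
    have : q - Ψ q = ∑ m ∈ q.support, C (coeff m q) * (monomial m 1 - Ψ (monomial m 1)) := by
      conv_lhs => rw [hs]
      rw [map_sum, ← Finset.sum_sub_distrib]
      refine Finset.sum_congr rfl fun m _ => ?_
      rw [map_smul, ← smul_sub, smul_eq_C_mul]
    rw [this]
    refine Ideal.sum_mem _ fun m hm => Ideal.mul_mem_left _ _ (hmon m ?_)
    have := hq (mem_support_iff.mp hm)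
    rwa [Finsupp.degree_eq_weight_one]
  have hker : LinearMap.ker Φ = Submodule.comap (homogeneousSubmodule (Fin n × Fin n) ℂ t).subtype
            (Submodule.restrictScalars ℂ (permIdeal n 2)) := by
    ext q
    rw [LinearMap.mem_ker, Submodule.mem_comap, Submodule.restrictScalars_mem,
      Submodule.subtype_apply]
    constructor
    · intro h
      have h1 := hred q.1 q.2
      have h2 : Ψ q.1 = 0 := by
        rw [hΨ]
        refine Finset.sum_eq_zero fun p _ => ?_
        rw [← hΦ, h]; simp
      rwa [h2, sub_zero] at h1
    · intro h
      ext p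
      rw [hΦ]
      exact Lfun_kill _ _ (hε p) h
  have hsurj : Function.Surjective Φ := by
    intro v
    refine ⟨⟨∑ p : G, (v p * (ε p (m0 p))⁻¹) • monomial (m0 p) 1, ?_⟩, ?_⟩
    · refine Submodule.sum_mem _ fun p _ => Submodule.smul_mem _ _ ?_
      exact isHomogeneous_monomial _ (hdeg0 p)
    · ext p
      rw [hΦ, map_sum, Finset.sum_eq_single p]
      · rw [map_smul, hL0, if_pos rfl, smul_eq_mul, mul_assoc, inv_mul_cancel₀ (hne p), mul_one]
      · intro p' _ hp'
        rw [map_smul, hL0, if_neg hp'.symm, smul_zero]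
      · simp
  rw [← hker, (Φ.quotKerEquivOfSurjective hsurj).finrank_eq]
  simp

noncomputable def A (n t : ℕ) : Finset (Fin n →₀ ℕ) := Finset.finsuppAntidiag Finset.univ t

lemma mem_A {t : ℕ} {r : Fin n →₀ ℕ} : r ∈ A n t ↔ r.degree = t := by
  rw [A, Finset.mem_finsuppAntidiag, Finsupp.degree_eq_sum]; simp

lemma card_A (t : ℕ) : (A n t).card = (n + t - 1).choose t := by
  rw [A, Finset.card_finsuppAntidiag_nat_eq_choose]; simp

lemma card_A01 (t : ℕ) : ((A n t).filter (fun r => ∀ i, r i ≤ 1)).card = n.choose t := by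
  have h : ((Finset.univ : Finset (Fin n)).powersetCard t).card = n.choose t := by simp
  rw [← h]
  refine Finset.card_bij (fun r _ => r.support) ?_ ?_ ?_
  · intro r hr
    rw [Finset.mem_filter, mem_A] at hr
    rw [Finset.mem_powersetCard]
    exact ⟨Finset.subset_univ _, by rw [card_support_01 r hr.2, hr.1]⟩
  · intro r hr r' hr' h
    rw [Finset.mem_filter] at hr hr'
    rw [← sum_single_01 r hr.2, ← sum_single_01 r' hr'.2, h]
  · intro s hs
    rw [Finset.mem_powersetCard] at hs
    have h01 : ∀ i, (Finsupp.indicator s (fun _ _ => 1) : Fin n →₀ ℕ) i ≤ 1 := by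
      intro i
      rw [Finsupp.indicator_apply]; split_ifs <;> simp
    have hsup : (Finsupp.indicator s (fun _ _ => 1) : Fin n →₀ ℕ).support = s := by
      ext i
      simp [Finsupp.indicator_apply]
    refine ⟨Finsupp.indicator s (fun _ _ => 1), ?_, hsup⟩
    rw [Finset.mem_filter, mem_A]
    exact ⟨by rw [← card_support_01 _ h01, hsup, hs.2], h01⟩

lemma card_A1 (t : ℕ) (ht : 1 ≤ t) :
    ((A n t).filter (fun r => r.support.card = 1)).card = n := by
  have h : (Finset.univ : Finset (Fin n)).card = n := by simp
  conv_rhs => rw [← h]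
  symm
  refine Finset.card_bij (fun i _ => Finsupp.single i t) ?_ ?_ ?_
  · intro i _
    rw [Finset.mem_filter, mem_A]
    refine ⟨by simp, ?_⟩
    rw [Finsupp.support_single _ (by omega)]; simp
  · intro i _ j _ h
    rw [Finsupp.single_eq_single_iff] at h
    rcases h with h | h
    · exact h.1
    · omega
  · intro r hr
    rw [Finset.mem_filter, mem_A] at hr
    obtain ⟨i, b, hb, rfl⟩ := Finsupp.card_support_eq_one'.mp hr.2
    exact ⟨i, Finset.mem_univ _, by simp at hr; rw [hr.1]⟩

lemma card_A2 (t : ℕ) :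
    ((A n t).filter (fun r => r.support.card = 2)).card = n.choose 2 * (t - 1) := by
  have h : ((Finset.univ : Finset (Fin n)).powersetCard 2).card = n.choose 2 := by simp
  rw [← h]
  rw [Finset.card_eq_sum_card_fiberwise (f := fun r => r.support)
    (t := (Finset.univ : Finset (Fin n)).powersetCard 2)]
  · rw [Finset.sum_const_nat]
    intro s hs
    rw [Finset.mem_powersetCard] at hs
    obtain ⟨a, b, hab, rfl⟩ := Finset.card_eq_two.mp hs.2
    rw [show t - 1 = (Finset.Ico 1 t).card by simp]
    symm
    refine Finset.card_bij (fun x _ => Finsupp.single a x + Finsupp.single b (t - x)) ?_ ?_ ?_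
    · intro x hx
      rw [Finset.mem_Ico] at hx
      have hsup : (Finsupp.single a x + Finsupp.single b (t - x)).support = {a, b} := by
        ext i
        simp only [Finsupp.mem_support_iff, Finsupp.add_apply, Finsupp.single_apply,
          Finset.mem_insert, Finset.mem_singleton]
        by_cases h1 : a = i
        · subst h1; simp; omega
        · by_cases h2 : b = i
          · subst h2; simp [h1]; omega
          · simp [h1, h2, Ne.symm h1, Ne.symm h2]
      rw [Finset.mem_filter, Finset.mem_filter, mem_A, hsup]
      refine ⟨⟨?_, Finset.card_pair hab⟩, rfl⟩
      rw [map_add, Finsupp.degree_single, Finsupp.degree_single]; omega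
    · intro x _ y _ h
      have := DFunLike.congr_fun h a
      simpa [Finsupp.single_apply, hab.symm] using this
    · intro r hr
      rw [Finset.mem_filter, Finset.mem_filter, mem_A] at hr
      obtain ⟨⟨hd, _⟩, hsup⟩ := hr
      rw [Finsupp.degree_apply, hsup, Finset.sum_pair hab] at hd
      have ha : r a ≠ 0 := by rw [← Finsupp.mem_support_iff, hsup]; simp
      have hb : r b ≠ 0 := by rw [← Finsupp.mem_support_iff, hsup]; simp
      refine ⟨r a, by rw [Finset.mem_Ico]; omega, ?_⟩
      ext i
      simp only [Finsupp.add_apply, Finsupp.single_apply]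
      by_cases h1 : a = i
      · subst h1; simp [hab.symm]
      · by_cases h2 : b = i
        · subst h2; simp [h1]; omega
        · have : i ∉ r.support := by rw [hsup]; simp [Ne.symm h1, Ne.symm h2]
          rw [Finsupp.notMem_support_iff] at this
          simp [h1, h2, this]
  · intro r hr
    simp only [Finset.coe_filter, Set.mem_ofPred_eq] at hr
    simp [Finset.mem_powersetCard, hr.2]

open Classical in
lemma card_G (t : ℕ) (ht : 3 ≤ t) :
    ((((A n t) ×ˢ (A n t)).filter Good).card : ℤ) =
      (n.choose t : ℤ) ^ 2 + 2 * n * ((n + t - 1).choose t : ℤ) - (n : ℤ) ^ 2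
        + (n.choose 2 * (t - 1 : ℕ) : ℤ) ^ 2 := by
  set B0 := (A n t).filter (fun r => ∀ i, r i ≤ 1) with hB0
  set B1 := (A n t).filter (fun r => r.support.card = 1) with hB1
  set B2 := (A n t).filter (fun r => r.support.card = 2) with hB2
  have hU : ((A n t) ×ˢ (A n t)).filter Good =
      (B0 ×ˢ B0) ∪ ((B1 ×ˢ A n t ∪ A n t ×ˢ B1) ∪ B2 ×ˢ B2) := by
    ext p
    simp only [hB0, hB1, hB2, Finset.mem_filter, Finset.mem_product, Finset.mem_union, Good]
    by_cases h1 : p.1 ∈ A n t <;> by_cases h2 : p.2 ∈ A n t <;> simp [h1, h2, or_assoc]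
  have d01 : ∀ r ∈ B0, r.support.card = t := by
    intro r hr
    rw [hB0, Finset.mem_filter, mem_A] at hr
    rw [card_support_01 r hr.2, hr.1]
  have D1 : Disjoint (B0 ×ˢ B0) ((B1 ×ˢ A n t ∪ A n t ×ˢ B1) ∪ B2 ×ˢ B2) := by
    rw [Finset.disjoint_left]
    intro p hp hq
    rw [Finset.mem_product] at hp
    have e1 := d01 _ hp.1
    have e2 := d01 _ hp.2
    simp only [hB1, hB2, Finset.mem_filter, Finset.mem_product, Finset.mem_union] at hq
    omega
  have D2 : Disjoint (B1 ×ˢ A n t ∪ A n t ×ˢ B1) (B2 ×ˢ B2) := by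
    rw [Finset.disjoint_left]
    intro p hp hq
    simp only [hB1, hB2, Finset.mem_filter, Finset.mem_product, Finset.mem_union] at hp hq
    omega
  have hI : (B1 ×ˢ A n t) ∩ (A n t ×ˢ B1) = B1 ×ˢ B1 := by
    ext p
    simp only [hB1, Finset.mem_filter, Finset.mem_product, Finset.mem_inter]
    by_cases h1 : p.1 ∈ A n t <;> by_cases h2 : p.2 ∈ A n t <;> simp [h1, h2]
  have hc := Finset.card_union_add_card_inter (B1 ×ˢ A n t) (A n t ×ˢ B1)
  rw [hI] at hc
  rw [hU, Finset.card_union_of_disjoint D1, Finset.card_union_of_disjoint D2]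
  simp only [Finset.card_product] at hc ⊢
  have c0 : B0.card = n.choose t := card_A01 t
  have c1 : B1.card = n := card_A1 t (by omega)
  have c2 : B2.card = n.choose 2 * (t - 1) := card_A2 t
  rw [c1, card_A] at hc
  rw [c0, c2]
  push_cast
  zify at hc
  linear_combination hc

lemma vander (n s : ℕ) (h : s + 1 ≤ n) :
    ∑ i ∈ Finset.range n, n.choose (i + 1) * s.choose i = (n + s).choose (s + 1) := by
  rw [Nat.add_choose_eq, Finset.Nat.sum_antidiagonal_eq_sum_range_succ_mk, Finset.sum_range_succ']
  simp only [Nat.sub_zero, Nat.choose_succ_self, mul_zero, add_zero]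
  symm
  have : ∑ k ∈ Finset.range (s + 1), n.choose (k + 1) * s.choose (s + 1 - (k + 1)) =
      ∑ k ∈ Finset.range (s + 1), n.choose (k + 1) * s.choose k := by
    refine Finset.sum_congr rfl fun k hk => ?_
    rw [Finset.mem_range] at hk
    rw [Nat.add_sub_add_right, Nat.choose_symm (by omega)]
  rw [this]
  refine Finset.sum_subset (Finset.range_mono h) fun k _ hk => ?_
  rw [Finset.mem_range, not_lt] at hk
  rw [Nat.choose_eq_zero_of_lt (show s < k by omega), mul_zero]

lemma two_choose (m : ℕ) : 2 * (m.choose 2 : ℤ) = m * (m - 1) := by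
  induction m with
  | zero => simp
  | succ k ih =>
    rw [Nat.choose_succ_succ' k 1, Nat.choose_one_right]
    push_cast
    linear_combination ih

lemma arith (n : ℕ) (hn : 3 ≤ n) (f : ℕ → ℤ)
    (hf0 : f 0 = (n : ℤ) ^ 2)
    (hf1 : f 1 = ((n ^ 2).choose 2 : ℤ) - (n.choose 2 : ℤ) ^ 2)
    (hf2 : f 2 = 2 * (n.choose 2 : ℤ) ^ 2 + 2 * (n : ℤ) * (n.choose 3 : ℤ))
    (hfi : ∀ i, 3 ≤ i → i ≤ n - 1 → f i = 2 * (n : ℤ) * (n.choose (i + 1) : ℤ))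
    (s : ℕ) (h : s + 1 ≤ n) :
    ∑ i ∈ Finset.range n, f i * (s.choose i : ℤ) =
      2 * n * ((n + s).choose (s + 1) : ℤ) - (n : ℤ) ^ 2 + (n.choose 2 * s : ℤ) ^ 2 := by
  rw [← vander n s h]
  push_cast
  obtain ⟨k, hk⟩ : ∃ k, n = k + 3 := ⟨n - 3, by omega⟩
  have e : Finset.range n = Finset.range (k + 3) := by rw [hk]
  rw [e]
  simp only [Finset.sum_range_succ', zero_add, Nat.reduceAdd, add_assoc]
  rw [hf0, hf1, hf2]
  have : ∑ i ∈ Finset.range k, f (i + 3) * (s.choose (i + 3) : ℤ) =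
      2 * n * ∑ i ∈ Finset.range k, (n.choose (i + 4) : ℤ) * (s.choose (i + 3) : ℤ) := by
    rw [Finset.mul_sum]
    refine Finset.sum_congr rfl fun i hi => ?_
    rw [Finset.mem_range] at hi
    rw [hfi (i + 3) (by omega) (by omega)]; ring
  rw [this]
  have a1 := two_choose n
  have a2 := two_choose (n ^ 2)
  have a3 := two_choose s
  push_cast at a2
  simp only [Nat.choose_zero_right, Nat.choose_one_right, Nat.cast_one]
  generalize (n.choose 2 : ℤ) = c at *
  generalize ((n ^ 2).choose 2 : ℤ) = d at *
  generalize (s.choose 2 : ℤ) = w at *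
  have a4 : d - c ^ 2 - 2 * n * c = c ^ 2 := by
    have : 2 * (d - c ^ 2 - 2 * n * c) = 2 * c ^ 2 := by
      linear_combination a2 - (2 * c + n * (n - 1) + 2 * n) * a1
    linarith
  linear_combination s * a4 + c ^ 2 * a3

end PermTwo

/-- For `n ≥ 3`, `I = I^{perm_n,2}` and `3 ≤ t ≤ n`, the dimension of the degree-`t` component
`S_t/(I ∩ S_t)` of `S/I` is `C(n,t)² + Σ_{i=0}^{n-1} f_i · C(t-1,i)`, where `f_0 = n²`,
`f_1 = C(n²,2) − C(n,2)²`, `f_2 = 2C(n,2)² + 2n·C(n,3)` and `f_i = 2n·C(n,i+1)` for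
`3 ≤ i ≤ n−1`. -/
theorem hilbertFunction_perm_two_quotient_low (n : ℕ) (hn : 3 ≤ n) (f : ℕ → ℤ)
    (hf0 : f 0 = (n : ℤ) ^ 2)
    (hf1 : f 1 = ((n ^ 2).choose 2 : ℤ) - (n.choose 2 : ℤ) ^ 2)
    (hf2 : f 2 = 2 * (n.choose 2 : ℤ) ^ 2 + 2 * (n : ℤ) * (n.choose 3 : ℤ))
    (hfi : ∀ i, 3 ≤ i → i ≤ n - 1 → f i = 2 * (n : ℤ) * (n.choose (i + 1) : ℤ))
    (t : ℕ) (ht3 : 3 ≤ t) (htn : t ≤ n) :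
    (Module.finrank ℂ
        (↥(homogeneousSubmodule (Fin n × Fin n) ℂ t) ⧸
          Submodule.comap (homogeneousSubmodule (Fin n × Fin n) ℂ t).subtype
            (Submodule.restrictScalars ℂ (permIdeal n 2))) : ℤ) =
      (n.choose t : ℤ) ^ 2 + ∑ i ∈ Finset.range n, f i * ((t - 1).choose i : ℤ) := by

  classical
  rw [PermTwo.finrank_eq_card t ht3
    (((PermTwo.A n t) ×ˢ (PermTwo.A n t)).filter PermTwo.Good) (by
      intro p
      rw [Finset.mem_filter, Finset.mem_product, PermTwo.mem_A, PermTwo.mem_A, and_assoc])]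
  obtain ⟨s, rfl⟩ : ∃ s, t = s + 1 := ⟨t - 1, by omega⟩
  have h1 := PermTwo.card_G (n := n) (s + 1) ht3
  have h2 := PermTwo.arith n hn f hf0 hf1 hf2 hfi s htn
  simp only [Nat.add_sub_cancel] at h1 ⊢
  rw [h2]
  have e : n + (s + 1) - 1 = n + s := by omega
  rw [e] at h1
  convert h1 using 1
  ring
end
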